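/- arXiv:2004.09090 — 2 statements merged into one kernel-verified Lean document; each statement's English description precedes it below -/
import Mathlib

section
/- If G is a finite simple graph with chromatic number exactly 4 and no connected component of G is isomorphic to K_2, then G admits an edge labelling ℓ : E(G) → {1,2,3} such that for every edge uv of G, the product of the labels of the edges incident to u differs from the product of the labels of the edges incident to v. -/
open Finset

/-- The product of the labels assigned by `ℓ` to the edges incident to `v`
(an empty product equals `1`). -/
def vertexProd {V : Type*} [Fintype V] [DecidableEq V] (G : SimpleGraph V)
    [DecidableRel G.Adj] (ℓ : Sym2 V → ℕ) (v : V) : ℕ :=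
  ∏ e ∈ G.incidenceFinset v, ℓ e

namespace Mult

open Classical in
/-- Number of neighbours `u` of `v` with `f v u = i`. -/
noncomputable def cnt {V : Type*} [Fintype V] (G : SimpleGraph V) (f : V → V → ℕ) (i : ℕ)
    (v : V) : ℕ := (univ.filter fun u => G.Adj v u ∧ f v u = i).card

theorem greedy {V : Type*} [Fintype V] (G : SimpleGraph V) (hc : G.Colorable 4) :
    ∃ col : V → ℕ, (∀ u v, G.Adj u v → col u ≠ col v) ∧ (∀ v, col v < 4) ∧
      ∀ v j, j < col v → ∃ u, G.Adj v u ∧ col u = j := by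
  classical
  have hex : ∃ n, ∃ col : V → ℕ, (∀ u v, G.Adj u v → col u ≠ col v) ∧ (∀ v, col v < 4) ∧
      ∑ v, col v = n := by
    obtain ⟨c⟩ := hc
    refine ⟨_, fun v => (c v : ℕ), ?_, fun v => (c v).2, rfl⟩
    intro u v h he
    exact c.valid h (Fin.ext he)
  obtain ⟨col, hp, h4, hs⟩ := Nat.find_spec hex
  refine ⟨col, hp, h4, ?_⟩
  intro v j hj
  by_contra hno
  push Not at hno
  have hlt : ∑ u, Function.update col v j u < ∑ u, col u := by
    apply Finset.sum_lt_sum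
    · intro u _
      by_cases h : u = v
      · subst h; simp; omega
      · simp [Function.update_of_ne h]
    · exact ⟨v, mem_univ _, by simpa using hj⟩
  rw [hs] at hlt
  refine Nat.find_min hex hlt ⟨Function.update col v j, ?_, ?_, rfl⟩
  · intro a b hab
    have hne := hab.ne
    by_cases ha : a = v
    · subst ha
      rw [Function.update_self, Function.update_of_ne hne.symm]
      exact fun h => hno b hab h.symm
    · by_cases hb : b = v
      · subst hb
        rw [Function.update_self, Function.update_of_ne hne]
        exact hno a hab.symm
      · rw [Function.update_of_ne ha, Function.update_of_ne hb]
        exact hp a b hab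
  · intro u
    by_cases h : u = v
    · subst h; rw [Function.update_self]; have := h4 u; omega
    · rw [Function.update_of_ne h]; exact h4 u

theorem path {V : Type*} [Fintype V] (H : SimpleGraph V) [DecidableEq V] {u v : V}
    (h : H.Reachable u v) :
    ∃ x : V → V → ZMod 2, (∀ a b, x a b = x b a) ∧ (∀ a b, ¬ H.Adj a b → x a b = 0) ∧
      ∀ w, ∑ y, x w y = (if w = u then 1 else 0) + (if w = v then 1 else 0) := by
  obtain ⟨p⟩ := h
  induction p with
  | nil =>
    refine ⟨fun _ _ => 0, by simp, by simp, ?_⟩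
    intro w
    split_ifs
    · simp; decide
    · simp
  | @cons a b c hab p ih =>
    obtain ⟨x, h1, h2, h3⟩ := ih
    refine ⟨fun s t => x s t + ((if s = a then 1 else 0) * (if t = b then 1 else 0) +
      (if s = b then 1 else 0) * (if t = a then 1 else 0)), ?_, ?_, ?_⟩
    · intro s t; simp only; rw [h1 s t]; ring
    · intro s t hst
      simp only
      rw [h2 s t hst]
      by_cases e1 : s = a ∧ t = b
      · exact absurd (by rw [e1.1, e1.2]; exact hab) hst
      · by_cases e2 : s = b ∧ t = a
        · exact absurd (by rw [e2.1, e2.2]; exact hab.symm) hst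
        · split_ifs <;> simp_all
    · intro w
      simp only
      rw [Finset.sum_add_distrib, h3 w, Finset.sum_add_distrib, ← Finset.mul_sum,
        ← Finset.mul_sum]
      simp only [Finset.sum_ite_eq', mem_univ, if_true, mul_one]
      have : ∀ t : ZMod 2, t + t = 0 := by decide
      linear_combination this (if w = b then 1 else 0)

theorem tjoin {V : Type*} [Fintype V] (H : SimpleGraph V) (τ : V → ZMod 2)
    (r : V → V) (hr : ∀ v, H.Reachable v (r v)) :
    ∃ x : V → V → ZMod 2, (∀ a b, x a b = x b a) ∧ (∀ a b, ¬ H.Adj a b → x a b = 0) ∧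
      ∀ w, (∀ v, r v ≠ w) → ∑ y, x w y = τ w := by
  classical
  choose P h1 h2 h3 using fun v => path H (hr v)
  refine ⟨fun a b => ∑ v, τ v * P v a b, ?_, ?_, ?_⟩
  · intro a b; exact Finset.sum_congr rfl fun v _ => by rw [h1]
  · intro a b hab; exact Finset.sum_eq_zero fun v _ => by rw [h2 v a b hab, mul_zero]
  · intro w hw
    rw [Finset.sum_comm]
    simp_rw [← Finset.mul_sum, h3]
    have : ∀ v, (if w = r v then (1 : ZMod 2) else 0) = 0 := fun v => if_neg (fun h => hw v h.symm)
    simp [this]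

theorem parity {V : Type*} [Fintype V] [DecidableEq V] (x : V → ZMod 2) :
    (((univ.filter fun v => x v = 1).card : ℕ) : ZMod 2) = ∑ v, x v := by
  rw [Finset.card_filter, Nat.cast_sum]
  refine Finset.sum_congr rfl fun v _ => ?_
  have : ∀ t : ZMod 2, (((if t = 1 then 1 else 0 : ℕ)) : ZMod 2) = t := by decide
  exact this (x v)

/-- Choice of the 3-labelled edges at a special vertex. -/
theorem xlemma {V : Type*} [DecidableEq V] (M : Finset V) (β : V → ℕ) :
    ∃ X ⊆ M, ∃ k, 1 ≤ k ∧ (X.card = k ∨ X.card + 1 = k) ∧ (∀ c ∈ X, β c + 1 ≠ k) ∧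
      ∀ c ∈ M, c ∉ X → β c ≠ k := by
  -- N k = number with β = k
  have key : ∀ k, 1 ≤ k → (M.filter fun c => β c = k).card ≤ k →
      k ≤ (M.filter fun c => ¬ β c + 1 = k).card + 1 →
      ∃ X ⊆ M, ∃ k, 1 ≤ k ∧ (X.card = k ∨ X.card + 1 = k) ∧ (∀ c ∈ X, β c + 1 ≠ k) ∧
      ∀ c ∈ M, c ∉ X → β c ≠ k := by
    intro k hk h1 h2
    have hsub : (M.filter fun c => β c = k) ⊆ (M.filter fun c => ¬ β c + 1 = k) := by
      intro c hc
      simp only [mem_filter] at hc ⊢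
      exact ⟨hc.1, by omega⟩
    have hle := Finset.card_le_card hsub
    obtain ⟨n, hn1, hn2, hn3⟩ : ∃ n, (M.filter fun c => β c = k).card ≤ n ∧
      n ≤ (M.filter fun c => ¬ β c + 1 = k).card ∧ (n = k ∨ n + 1 = k) := by
      by_cases h : k ≤ (M.filter fun c => ¬ β c + 1 = k).card
      · exact ⟨k, h1, h, Or.inl rfl⟩
      · exact ⟨k - 1, by omega, by omega, by omega⟩
    obtain ⟨X, hX1, hX2, hX3⟩ := Finset.exists_subsuperset_card_eq hsub hn1 hn2
    refine ⟨X, hX2.trans (filter_subset _ _), k, hk, by omega, ?_, ?_⟩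
    · intro c hc; exact (mem_filter.1 (hX2 hc)).2
    · intro c hc hcX he
      exact hcX (hX1 (mem_filter.2 ⟨hc, he⟩))
  have hex : ∃ k, 1 ≤ k ∧ (M.filter fun c => β c = k).card ≤ k :=
    ⟨M.card + 1, by omega, (card_filter_le _ _).trans (by omega)⟩
  classical
  obtain ⟨hk1, hk2⟩ := Nat.find_spec hex
  have hmin : ∀ j, 1 ≤ j → j < Nat.find hex → j + 1 ≤ (M.filter fun c => β c = j).card := by
    intro j hj hlt
    have := Nat.find_min hex hlt
    by_contra hc
    exact this ⟨hj, by omega⟩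
  set k := Nat.find hex with hkdef
  by_cases hk3 : k = 1
  · exact key k hk1 hk2 (by omega)
  by_cases hk4 : k = 2
  · by_cases hall : ∀ c ∈ M, β c = 1
    · have hM : 2 ≤ M.card := by
        have := hmin 1 le_rfl (by omega)
        exact this.trans (card_filter_le _ _)
      refine key 3 (by omega) ?_ ?_
      · rw [Finset.filter_false_of_mem]; · simp
        intro c hc; rw [hall c hc]; omega
      · rw [Finset.filter_true_of_mem]; · omega
        intro c hc; rw [hall c hc]; omega
    · push Not at hall
      obtain ⟨c, hc, hc1⟩ := hall
      refine key k hk1 hk2 ?_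
      have : 0 < (M.filter fun c => ¬ β c + 1 = k).card :=
        Finset.card_pos.2 ⟨c, mem_filter.2 ⟨hc, by omega⟩⟩
      omega
  · refine key k hk1 hk2 ?_
    have h1 := hmin (k - 2) (by omega) (by omega)
    have hsub : (M.filter fun c => β c = k - 2) ⊆ (M.filter fun c => ¬ β c + 1 = k) := by
      intro c hc
      simp only [mem_filter] at hc ⊢
      exact ⟨hc.1, by omega⟩
    have := Finset.card_le_card hsub
    omega

/-- From a symmetric labelling of ordered pairs to the conclusion. -/
theorem finish {V : Type*} [Fintype V] [DecidableEq V] (G : SimpleGraph V)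
    [DecidableRel G.Adj] (w : V → V → ℕ) (hs : ∀ u v, G.Adj u v → w u v = w v u)
    (hv : ∀ u v, G.Adj u v → w u v = 1 ∨ w u v = 2 ∨ w u v = 3)
    (hd : ∀ u v, G.Adj u v → cnt G w 2 u = cnt G w 2 v → cnt G w 3 u = cnt G w 3 v → False) :
    ∃ ℓ : Sym2 V → ℕ,
      (∀ e ∈ G.edgeSet, ℓ e ∈ ({1, 2, 3} : Set ℕ)) ∧
      ∀ u v : V, G.Adj u v → vertexProd G ℓ u ≠ vertexProd G ℓ v := by
  classical
  let ℓ : Sym2 V → ℕ := Sym2.lift ⟨fun u v => if G.Adj u v then w u v else 1, by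
    intro u v
    by_cases h : G.Adj u v
    · simp [h, h.symm, hs u v h]
    · have h' : ¬ G.Adj v u := fun h' => h h'.symm
      simp [h, h']⟩
  have hℓ : ∀ u v, G.Adj u v → ℓ s(u, v) = w u v := by
    intro u v h; simp [ℓ, h]
  have hprod : ∀ v, vertexProd G ℓ v = 2 ^ cnt G w 2 v * 3 ^ cnt G w 3 v := by
    intro v
    have e1 : vertexProd G ℓ v = ∏ u ∈ univ.filter (fun u => G.Adj v u), w v u := by
      unfold vertexProd
      symm
      refine Finset.prod_bij (fun u _ => s(v, u)) ?_ ?_ ?_ ?_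
      · intro u hu; simpa using hu
      · intro a _ b _ hab; exact Sym2.congr_right.1 hab
      · intro e he
        rw [SimpleGraph.mem_incidenceFinset] at he
        obtain ⟨he1, he2⟩ := he
        obtain ⟨u, rfl⟩ := Sym2.mem_iff_exists.1 he2
        exact ⟨u, by simpa using he1, rfl⟩
      · intro u hu
        exact (hℓ v u (by simpa using hu)).symm
    have e2 : ∀ u ∈ univ.filter (fun u => G.Adj v u), w v u =
        (if w v u = 2 then 2 else 1) * (if w v u = 3 then 3 else 1) := by
      intro u hu
      rcases hv v u (by simpa using hu) with h | h | h <;> rw [h] <;> simp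
    rw [e1, Finset.prod_congr rfl e2, Finset.prod_mul_distrib, ← Finset.prod_filter,
      ← Finset.prod_filter, Finset.prod_const, Finset.prod_const, Finset.filter_filter,
      Finset.filter_filter]
    unfold cnt
    congr!
  have cop : ∀ a b c d : ℕ, 2 ^ a * 3 ^ b = 2 ^ c * 3 ^ d → a = c ∧ b = d := by
    intro a b c d h
    have h2 := congrArg (fun n => padicValNat 2 n) h
    have h3 := congrArg (fun n => padicValNat 3 n) h
    have p2 : Fact (Nat.Prime 2) := ⟨Nat.prime_two⟩
    have p3 : Fact (Nat.Prime 3) := ⟨Nat.prime_three⟩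
    have q1 : padicValNat 2 3 = 0 := padicValNat.eq_zero_of_not_dvd (by norm_num)
    have q2 : padicValNat 3 2 = 0 := padicValNat.eq_zero_of_not_dvd (by norm_num)
    rw [padicValNat.mul (by positivity) (by positivity),
      padicValNat.mul (by positivity) (by positivity)] at h2 h3
    simp only [padicValNat.pow, q1, q2, padicValNat_self] at h2 h3
    omega
  refine ⟨ℓ, ?_, ?_⟩
  · intro e
    induction e using Sym2.ind with
    | _ u v =>
      intro he
      have h : G.Adj u v := by simpa using he
      rw [hℓ u v h]
      simpa using hv u v h
  · intro u v h heq
    rw [hprod, hprod] at heq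
    obtain ⟨h1, h2⟩ := cop _ _ _ _ heq
    exact hd u v h h1 h2


theorem cnt_eq_zero {V : Type*} [Fintype V] (G : SimpleGraph V) (f : V → V → ℕ) (i : ℕ) (v : V) :
    cnt G f i v = 0 ↔ ∀ u, G.Adj v u → f v u ≠ i := by
  unfold cnt
  classical
  rw [Finset.card_eq_zero]
  constructor
  · intro he u hu hf
    have : u ∈ (∅ : Finset V) := by rw [← he]; simp [hu, hf]
    simp at this
  · intro hu
    ext u
    simp only [mem_filter, mem_univ, true_and, notMem_empty, iff_false]
    exact fun hc => hu u hc.1 hc.2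

theorem cnt_congr {V : Type*} [Fintype V] (G : SimpleGraph V) (f f' : V → V → ℕ) (i i' : ℕ)
    (v : V) (h : ∀ u, G.Adj v u → (f v u = i ↔ f' v u = i')) : cnt G f i v = cnt G f' i' v := by
  unfold cnt
  congr 1
  ext u
  simp only [mem_filter, mem_univ, true_and]
  exact and_congr_right fun hu => h u hu

theorem cnt_pos {V : Type*} [Fintype V] (G : SimpleGraph V) (f : V → V → ℕ) (i : ℕ) (v u : V)
    (h : G.Adj v u) (hf : f v u = i) : 1 ≤ cnt G f i v := by
  by_contra hc
  exact (cnt_eq_zero G f i v).1 (by omega) u h hf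

theorem cnt_eq_one {V : Type*} [Fintype V] (G : SimpleGraph V) (f : V → V → ℕ) (i : ℕ) (v u : V)
    (h : G.Adj v u) (hf : f v u = i) (hu : ∀ y, G.Adj v y → f v y = i → y = u) :
    cnt G f i v = 1 := by
  unfold cnt
  rw [Finset.card_eq_one]
  refine ⟨u, ?_⟩
  ext y
  simp only [mem_filter, mem_univ, true_and, mem_singleton]
  exact ⟨fun hy => hu y hy.1 hy.2, fun hy => by rw [hy]; exact ⟨h, hf⟩⟩

theorem cnt_two {V : Type*} [Fintype V] (G : SimpleGraph V) (f : V → V → ℕ) (i : ℕ) (v u u' : V)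
    (h : G.Adj v u) (hf : f v u = i) (h' : G.Adj v u') (hf' : f v u' = i) (hne : u ≠ u') :
    2 ≤ cnt G f i v := by
  classical
  unfold cnt
  rw [← Finset.card_pair hne]
  apply Finset.card_le_card
  intro y hy
  simp only [mem_insert, mem_singleton] at hy
  rcases hy with rfl | rfl <;> simp [h, hf, h', hf']

open Classical in
theorem fix {V : Type*} [Fintype V] (G : SimpleGraph V) (col : V → ℕ) (st : V → Prop)
    (hst0 : ∀ a, st a → col a = 0) (hst : ∀ a u, st a → G.Adj a u → col u = 1)
    (hA : ∀ b, col b = 1 → ∃ u, G.Adj b u ∧ col u = 0)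
    (hnice : ∀ u v, G.Adj u v → (∃ y, y ≠ v ∧ G.Adj u y) ∨ (∃ y, y ≠ u ∧ G.Adj v y))
    (g0 : V → V → ℕ) (h : Set V) (hcl : ∀ a b, a ∈ h → st a → G.Adj a b → b ∈ h)
    (hg0 : ∀ b v, g0 b v = 1 ∨ g0 b v = 2)
    (hA1 : ∀ b v, col b = 1 → G.Adj b v → col v = 0 → ¬ st v → g0 b v = 1)
    (hre : ∀ b0 ∈ h, col b0 = 1 → ∃ g : V → V → ℕ, (∀ b v, g b v = 1 ∨ g b v = 2) ∧
      (∀ b v, col b = 1 → ¬ st v → g b v = g0 b v) ∧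
      (∀ b ∈ h, col b = 1 → (Odd (cnt G g 2 b) ↔ b = b0)) ∧
      ∀ a ∈ h, st a → (∃ b, G.Adj a b) → Odd (cnt G (fun a b => g b a) 2 a))
    (β : V → ℕ) :
    ∃ g : V → V → ℕ, (∀ b v, g b v = 1 ∨ g b v = 2 ∨ g b v = 3) ∧
      (∀ b v, b ∈ h → col b = 1 → G.Adj b v → 2 ≤ col v → (g b v = 2 ↔ g0 b v = 2)) ∧
      (∀ b v, b ∈ h → col b = 1 → G.Adj b v → col v = 0 → ¬ st v → g b v ≠ 2) ∧
      (∀ b ∈ h, col b = 1 → cnt G g 3 b = 0 ∨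
        (cnt G g 2 b = 0 ∧ ∀ v, G.Adj b v → col v = 0 → st v) ∨
        (Odd (cnt G g 2 b) ∧ ∀ c, G.Adj b c → col c = 2 → cnt G g 3 b ≠ β c +
          (univ.filter fun b' => G.Adj c b' ∧ b' ∈ h ∧ col b' = 1 ∧ g b' c = 3).card)) ∧
      (∀ a b, a ∈ h → st a → G.Adj a b →
        cnt G (fun a b => g b a) 2 a = cnt G g 2 b →
        cnt G (fun a b => g b a) 3 a = cnt G g 3 b → False) := by
  let Z : V → Prop := fun b => b ∈ h ∧ col b = 1 ∧ ∀ v, G.Adj b v → ¬ st v → g0 b v ≠ 2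
  by_cases hZ : ∀ b, Z b → ∀ u v, G.Adj b u → G.Adj b v → u = v
  · -- F1
    have hpick : ∀ a, ∃ p, st a → a ∈ h → (∃ z, Z z ∧ G.Adj a z ∧ ∀ z', Z z' → G.Adj a z' → z' = z) →
        (G.Adj a p ∧ ¬ Z p) := by
      intro a
      by_cases hc : st a ∧ a ∈ h ∧ (∃ z, Z z ∧ G.Adj a z ∧ ∀ z', Z z' → G.Adj a z' → z' = z)
      · obtain ⟨h1, h2, z, hz, haz, huni⟩ := hc
        rcases hnice a z haz with ⟨y, hy, hay⟩ | ⟨y, hy, hay⟩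
        · exact ⟨y, fun _ _ _ => ⟨hay, fun hzy => hy (huni y hzy hay)⟩⟩
        · exact absurd (hZ z hz y a hay haz.symm) hy
      · exact ⟨a, fun h1 h2 h3 => absurd ⟨h1, h2, h3⟩ hc⟩
    choose pick hpick using hpick
    let U : V → Prop := fun a => ∃ z, Z z ∧ G.Adj a z ∧ ∀ z', Z z' → G.Adj a z' → z' = z
    let g : V → V → ℕ := fun b v => if st v then (if Z b then 3 else if U v ∧ b = pick v then 2 else 1)
      else g0 b v
    have gZ : ∀ b v, st v → Z b → g b v = 3 := fun b v h1 h2 => by simp [g, h1, h2]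
    have gN : ∀ b v, ¬ st v → g b v = g0 b v := fun b v h1 => by simp [g, h1]
    have gO : ∀ b v, st v → ¬ Z b → g b v = if U v ∧ b = pick v then 2 else 1 :=
      fun b v h1 h2 => by simp [g, h1, h2]
    have gO3 : ∀ b v, ¬ Z b → g b v ≠ 3 := by
      intro b v hb
      by_cases hv : st v
      · rw [gO b v hv hb]; split_ifs <;> omega
      · rw [gN b v hv]; have := hg0 b v; omega
    have stn : ∀ v, 2 ≤ col v → ¬ st v := fun v hv hs => by have := hst0 v hs; omega
    refine ⟨g, ?_, ?_, ?_, ?_, ?_⟩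
    · intro b v
      by_cases hv : st v
      · by_cases hb : Z b
        · exact Or.inr (Or.inr (gZ b v hv hb))
        · rw [gO b v hv hb]; split_ifs <;> omega
      · rw [gN b v hv]; have := hg0 b v; omega
    · intro b v _ _ _ hv
      rw [gN b v (stn v hv)]
    · intro b v _ hb hbv hv hs
      rw [gN b v hs, hA1 b v hb hbv hv hs]; omega
    · intro b hbh hb
      by_cases hzb : Z b
      · obtain ⟨u, hu, hu0⟩ := hA b hb
        by_cases hs : st u
        · right; left
          constructor
          · rw [cnt_eq_zero]
            intro v hv
            rw [hZ b hzb v u hv hu, gZ b u hs hzb]; omega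
          · intro v hv _
            rw [hZ b hzb v u hv hu]; exact hs
        · left
          rw [cnt_eq_zero]
          intro v hv
          rw [hZ b hzb v u hv hu, gN b u hs]
          have := hg0 b u; omega
      · left
        rw [cnt_eq_zero]
        intro v _
        exact gO3 b v hzb
    · intro a b hah hsa hab e2 e3
      have hbh := hcl a b hah hsa hab
      have hb := hst a b hsa hab
      by_cases hzb : Z b
      · have e2' : cnt G g 2 b = 0 := by
          rw [cnt_eq_zero]; intro v hv
          rw [hZ b hzb v a hv hab.symm, gZ b a hsa hzb]; omega
        have e3' : cnt G g 3 b = 1 := cnt_eq_one G g 3 b a hab.symm (gZ b a hsa hzb)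
          (fun y hy _ => hZ b hzb y a hy hab.symm)
        by_cases hU : U a
        · obtain ⟨q1, q2⟩ := hpick a hsa hah hU
          have := cnt_pos G (fun a b => g b a) 2 a (pick a) q1 (by
            rw [gO _ _ hsa q2, if_pos ⟨hU, rfl⟩])
          omega
        · have : ∃ z', Z z' ∧ G.Adj a z' ∧ z' ≠ b := by
            by_contra hc
            push Not at hc
            exact hU ⟨b, hzb, hab, hc⟩
          obtain ⟨z', q1, q2, q3⟩ := this
          have := cnt_two G (fun a b => g b a) 3 a z' b q2 (gZ z' a hsa q1) hab (gZ b a hsa hzb) q3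
          omega
      · have e3' : cnt G g 3 b = 0 := by
          rw [cnt_eq_zero]; intro v _; exact gO3 b v hzb
        have e2' : 1 ≤ cnt G g 2 b := by
          have : ∃ v, G.Adj b v ∧ ¬ st v ∧ g0 b v = 2 := by
            by_contra hc
            push Not at hc
            exact hzb ⟨hbh, hb, hc⟩
          obtain ⟨v, q1, q2, q3⟩ := this
          exact cnt_pos G g 2 b v q1 (by rw [gN b v q2, q3])
        rw [e3', cnt_eq_zero] at e3
        have hnZ : ∀ z, Z z → ¬ G.Adj a z := fun z hz haz => e3 z haz (gZ z a hsa hz)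
        have hnU : ¬ U a := fun ⟨z, q1, q2, _⟩ => hnZ z q1 q2
        have : cnt G (fun a b => g b a) 2 a = 0 := by
          rw [cnt_eq_zero]; intro y hy
          rw [gO y a hsa (fun hz => hnZ y hz hy), if_neg (fun hc => hnU hc.1)]; omega
        omega
  · push Not at hZ
    obtain ⟨b0, ⟨hb0h, hb0, hz0⟩, u1, u2, hu1, hu2, hu12⟩ := hZ
    obtain ⟨g', v1, v2, v3, v4⟩ := hre b0 hb0h hb0
    have stn : ∀ v, 2 ≤ col v → ¬ st v := fun v hv hs => by have := hst0 v hs; omega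
    by_cases hF : ∃ a1, G.Adj b0 a1 ∧ col a1 = 0 ∧ ¬ st a1
    · -- F2
      obtain ⟨a1, ha1, ha10, ha1s⟩ := hF
      obtain ⟨X, hXM, k, hk, hXk, hX1, hX2⟩ :=
        xlemma (univ.filter fun c => G.Adj b0 c ∧ col c = 2) β
      have hXc : ∀ c ∈ X, G.Adj b0 c ∧ col c = 2 := fun c hc => by simpa using hXM hc
      obtain ⟨T, hT1, hT2, hT3⟩ : ∃ T : Finset V, T.card = k ∧ (∀ v ∈ T, G.Adj b0 v ∧ ¬ st v) ∧
          ∀ c, col c = 2 → (c ∈ T ↔ c ∈ X) := by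
        rcases hXk with hX | hX
        · exact ⟨X, hX, fun v hv => ⟨(hXc v hv).1, stn v (by rw [(hXc v hv).2])⟩, fun c _ => Iff.rfl⟩
        · have : a1 ∉ X := fun hc => by have := (hXc a1 hc).2; omega
          refine ⟨insert a1 X, by rw [card_insert_of_notMem this, hX], ?_, ?_⟩
          · intro v hv
            rcases mem_insert.1 hv with rfl | hv
            · exact ⟨ha1, ha1s⟩
            · exact ⟨(hXc v hv).1, stn v (by rw [(hXc v hv).2])⟩
          · intro c hc
            rw [mem_insert, or_iff_right]
            rintro rfl; omega
      let g : V → V → ℕ := fun b v => if b = b0 ∧ v ∈ T then 3 else g' b v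
      have gT : ∀ b v, b = b0 → v ∈ T → g b v = 3 := fun b v h1 h2 => by simp [g, h1, h2]
      have gF : ∀ b v, ¬ (b = b0 ∧ v ∈ T) → g b v = g' b v := fun b v h1 => if_neg h1
      have gT' : ∀ v ∈ T, g' b0 v = 1 := by
        intro v hv
        obtain ⟨q1, q2⟩ := hT2 v hv
        have := v1 b0 v
        have := hz0 v q1 q2
        rw [← v2 b0 v hb0 q2] at this
        omega
      have g2 : ∀ b v, g b v = 2 ↔ g' b v = 2 := by
        intro b v
        by_cases hc : b = b0 ∧ v ∈ T
        · rw [gT b v hc.1 hc.2, hc.1, gT' v hc.2]; omega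
        · rw [gF b v hc]
      have g3 : ∀ b v, g b v = 3 ↔ b = b0 ∧ v ∈ T := by
        intro b v
        by_cases hc : b = b0 ∧ v ∈ T
        · rw [gT b v hc.1 hc.2]; exact ⟨fun _ => hc, fun _ => rfl⟩
        · rw [gF b v hc]; have := v1 b v; simp only [hc, iff_false]; omega
      have c2 : ∀ b, cnt G g 2 b = cnt G g' 2 b := fun b => cnt_congr _ _ _ _ _ _ fun u _ => g2 b u
      have c3 : cnt G g 3 b0 = k := by
        rw [← hT1]
        unfold cnt
        congr 1
        ext v
        simp only [mem_filter, mem_univ, true_and, g3]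
        exact ⟨fun hv => hv.2, fun hv => ⟨(hT2 v hv).1, hv⟩⟩
      have c3' : ∀ b, b ≠ b0 → cnt G g 3 b = 0 := by
        intro b hb
        rw [cnt_eq_zero]; intro u _ hc
        exact hb ((g3 b u).1 hc).1
      refine ⟨g, ?_, ?_, ?_, ?_, ?_⟩
      · intro b v
        by_cases hc : b = b0 ∧ v ∈ T
        · exact Or.inr (Or.inr (gT b v hc.1 hc.2))
        · rw [gF b v hc]; have := v1 b v; omega
      · intro b v _ hb _ hv
        rw [g2, v2 b v hb (stn v hv)]
      · intro b v _ hb hbv hv hs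
        rw [Ne, g2, v2 b v hb hs, hA1 b v hb hbv hv hs]; omega
      · intro b hbh hb
        by_cases hbb : b = b0
        · right; right
          subst hbb
          refine ⟨by rw [c2]; exact (v3 b hbh hb).2 rfl, ?_⟩
          intro c hbc hc
          rw [c3]
          by_cases hcX : c ∈ X
          · have : (univ.filter fun b' => G.Adj c b' ∧ b' ∈ h ∧ col b' = 1 ∧ g b' c = 3) = {b} := by
              ext y
              simp only [mem_filter, mem_univ, true_and, mem_singleton, g3]
              constructor
              · rintro ⟨_, _, _, q, _⟩; exact q
              · rintro rfl; exact ⟨hbc.symm, hbh, hb, rfl, (hT3 c hc).2 hcX⟩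
            rw [this, card_singleton]
            exact (hX1 c hcX).symm
          · have : (univ.filter fun b' => G.Adj c b' ∧ b' ∈ h ∧ col b' = 1 ∧ g b' c = 3) = ∅ := by
              rw [Finset.filter_eq_empty_iff]
              rintro y _ ⟨_, _, _, q⟩
              exact hcX ((hT3 c hc).1 ((g3 y c).1 q).2)
            rw [this, card_empty]
            exact (hX2 c (by simp [hbc, hc]) hcX).symm
        · left; exact c3' b hbb
      · intro a b hah hsa hab e2 e3
        have hbh := hcl a b hah hsa hab
        have hb := hst a b hsa hab
        have a3 : cnt G (fun a b => g b a) 3 a = 0 := by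
          rw [cnt_eq_zero]; intro u _ hc
          exact (hT2 a ((g3 u a).1 hc).2).2 hsa
        have a2 : cnt G (fun a b => g b a) 2 a = cnt G (fun a b => g' b a) 2 a :=
          cnt_congr _ _ _ _ _ _ fun u _ => g2 u a
        by_cases hbb : b = b0
        · rw [hbb, c3] at e3; omega
        · have := v4 a hah hsa ⟨b, hab⟩
          rw [← a2, e2, c2] at this
          exact hbb ((v3 b hbh hb).1 this)
    · -- F3
      push Not at hF
      let g : V → V → ℕ := fun b v => if b = b0 then 3 else g' b v
      have gT : ∀ v, g b0 v = 3 := fun v => by simp [g]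
      have gF : ∀ b v, b ≠ b0 → g b v = g' b v := fun b v h1 => if_neg h1
      have c2 : ∀ b, b ≠ b0 → cnt G g 2 b = cnt G g' 2 b :=
        fun b hb => cnt_congr _ _ _ _ _ _ fun u _ => by rw [gF b u hb]
      have c3' : ∀ b, b ≠ b0 → cnt G g 3 b = 0 := by
        intro b hb
        rw [cnt_eq_zero]; intro u _ hc
        rw [gF b u hb] at hc; have := v1 b u; omega
      refine ⟨g, ?_, ?_, ?_, ?_, ?_⟩
      · intro b v
        by_cases hc : b = b0
        · subst hc; exact Or.inr (Or.inr (gT v))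
        · rw [gF b v hc]; have := v1 b v; omega
      · intro b v _ hb hbv hv
        by_cases hc : b = b0
        · subst hc; rw [gT]
          have := hz0 v hbv (stn v hv)
          simp [this]
        · rw [gF b v hc, v2 b v hb (stn v hv)]
      · intro b v _ hb hbv hv hs
        by_cases hc : b = b0
        · subst hc; rw [gT]; omega
        · rw [gF b v hc, v2 b v hb hs, hA1 b v hb hbv hv hs]; omega
      · intro b hbh hb
        by_cases hbb : b = b0
        · right; left
          subst hbb
          exact ⟨by rw [cnt_eq_zero]; intro u _; rw [gT]; omega, hF⟩
        · left; exact c3' b hbb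
      · intro a b hah hsa hab e2 e3
        have hbh := hcl a b hah hsa hab
        have hb := hst a b hsa hab
        by_cases hab0 : G.Adj a b0
        · have a3 : cnt G (fun a b => g b a) 3 a = 1 := by
            refine cnt_eq_one _ _ _ _ b0 hab0 (gT a) ?_
            intro y _ hy
            by_contra hc
            rw [gF y a hc] at hy; have := v1 y a; omega
          by_cases hbb : b = b0
          · have := cnt_two G g 3 b0 u1 u2 hu1 (gT _) hu2 (gT _) hu12
            rw [hbb] at e3; omega
          · have := c3' b hbb; omega
        · have hbb : b ≠ b0 := fun hc => hab0 (hc ▸ hab)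
          have a2 : cnt G (fun a b => g b a) 2 a = cnt G (fun a b => g' b a) 2 a :=
            cnt_congr _ _ _ _ _ _ fun u hu => by
              rw [gF u a (fun hc => hab0 (hc ▸ hu))]
          have := v4 a hah hsa ⟨b, hab⟩
          rw [← a2, e2, c2 b hbb] at this
          exact hbb ((v3 b hbh hb).1 this)

/-- The graph of edges between special vertices and colour class 1. -/
def H0 {V : Type*} (G : SimpleGraph V) (col : V → ℕ) (st : V → Prop) : SimpleGraph V where
  Adj u v := G.Adj u v ∧ ((st u ∧ col v = 1) ∨ (col u = 1 ∧ st v))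
  symm := ⟨fun u v h => ⟨h.1.symm, by tauto⟩⟩
  loopless := ⟨fun u h => G.loopless.irrefl u h.1⟩

/-- The graph `H0` together with the edges between colour classes 1 and 2. -/
def K0 {V : Type*} (G : SimpleGraph V) (col : V → ℕ) (st : V → Prop) : SimpleGraph V where
  Adj u v := G.Adj u v ∧ ((st u ∧ col v = 1) ∨ (col u = 1 ∧ st v) ∨
    (col u = 1 ∧ col v = 2) ∨ (col u = 2 ∧ col v = 1))
  symm := ⟨fun u v h => ⟨h.1.symm, by tauto⟩⟩
  loopless := ⟨fun u h => G.loopless.irrefl u h.1⟩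

theorem H0_le_K0 {V : Type*} (G : SimpleGraph V) (col : V → ℕ) (st : V → Prop) :
    H0 G col st ≤ K0 G col st := by
  intro u v h
  exact ⟨h.1, by have := h.2; tauto⟩

open Classical in
/-- Labels of edges avoiding colour class 1. -/
noncomputable def qq {V : Type*} (col : V → ℕ) (cD : V → V) (u v : V) : ℕ :=
  if col u = 0 ∨ col v = 0 then 3 else
    if (col u = 3 ∧ cD u = v) ∨ (col v = 3 ∧ cD v = u) then 2 else 1

/-- The full labelling. -/
noncomputable def WW {V : Type*} (col : V → ℕ) (cD : V → V) (g : V → V → ℕ) (u v : V) : ℕ :=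
  if col u = 1 then g u v else if col v = 1 then g v u else qq col cD u v

open Classical in
/-- Labels of edges at colour class 1 given by a 0/1 vector. -/
noncomputable def gx {V : Type*} (col : V → ℕ) (bD : V → V) (x : V → V → ZMod 2) (b v : V) : ℕ :=
  if col v = 3 then (if bD v = b then 2 else 1) else if x b v = 1 then 2 else 1

theorem cardsum {V : Type*} [Fintype V] [DecidableEq V] (x : V → ZMod 2) (P Q : V → Prop)
    [DecidablePred P] [DecidablePred Q]
    (h : ∀ u, P u ↔ (x u = 1 ∨ Q u)) (hd : ∀ u, x u = 1 → ¬ Q u) :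
    (((univ.filter P).card : ℕ) : ZMod 2) = ∑ u, x u + ((univ.filter Q).card : ℕ) := by
  have : univ.filter P = univ.filter (fun u => x u = 1) ∪ univ.filter Q := by
    ext u; simp [h]
  rw [this, card_union_of_disjoint, Nat.cast_add, parity]
  rw [Finset.disjoint_filter]
  intro u _ hu
  exact hd u hu

open Classical in
theorem base {V : Type*} [Fintype V] (G : SimpleGraph V) (col : V → ℕ) (st : V → Prop)
    (hst0 : ∀ a, st a → col a = 0) (hst : ∀ a u, st a → G.Adj a u → col u = 1)
    (hB : ∀ c, col c = 2 → ∃ u, G.Adj c u ∧ col u = 1)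
    (bD cD : V → V) (hbD : ∀ d, col d = 3 → G.Adj d (bD d) ∧ col (bD d) = 1)
    (hcD : ∀ d, col d = 3 → G.Adj d (cD d) ∧ col (cD d) = 2) :
    ∃ g0 : V → V → ℕ, (∀ b v, g0 b v = 1 ∨ g0 b v = 2) ∧
      (∀ b v, col b = 1 → G.Adj b v → col v = 0 → ¬ st v → g0 b v = 1) ∧
      (∀ b d, col d = 3 → (g0 b d = 2 ↔ bD d = b)) ∧
      (∀ c, col c = 2 → Odd (cnt G (WW col cD g0) 2 c)) ∧
      (∀ a, st a → (∃ b, G.Adj a b) → Odd (cnt G (fun a b => g0 b a) 2 a)) ∧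
      (∀ r r', col r = 1 → col r' = 1 → Odd (cnt G g0 2 r) → Odd (cnt G g0 2 r') →
        (K0 G col st).Reachable r r' → r = r') ∧
      (∀ r, col r = 1 → Odd (cnt G g0 2 r) → ∀ b0, (H0 G col st).Reachable r b0 → col b0 = 1 →
        ∃ g : V → V → ℕ, (∀ b v, g b v = 1 ∨ g b v = 2) ∧
        (∀ b v, col b = 1 → ¬ st v → g b v = g0 b v) ∧
        (∀ b, (H0 G col st).Reachable r b → col b = 1 → (Odd (cnt G g 2 b) ↔ b = b0)) ∧
        ∀ a, (H0 G col st).Reachable r a → st a → (∃ b, G.Adj a b) →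
          Odd (cnt G (fun a b => g b a) 2 a)) := by
  have odd1 : ∀ n : ℕ, Odd n ↔ ((n : ℕ) : ZMod 2) = 1 := fun n => (ZMod.natCast_eq_one_iff_odd).symm
  have two : ∀ t : ZMod 2, t + t = 0 := by decide
  have z01 : ∀ t : ZMod 2, t ≠ 1 ↔ t = 0 := by decide
  have z10 : ∀ t : ZMod 2, t = 1 ∨ t = 0 := by decide
  -- parities of a vector
  have cb : ∀ x : V → V → ZMod 2, (∀ a b, ¬ (K0 G col st).Adj a b → x a b = 0) → ∀ b, col b = 1 →
      ((cnt G (gx col bD x) 2 b : ℕ) : ZMod 2) =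
        ∑ y, x b y + ((univ.filter fun d => col d = 3 ∧ bD d = b).card : ℕ) := by
    intro x hx b hb
    have hK : ∀ u, x b u = 1 → (K0 G col st).Adj b u := by
      intro u hu; by_contra hc; rw [hx b u hc] at hu; exact absurd hu (by decide)
    have hc3 : ∀ u, x b u = 1 → col u ≠ 3 := by
      intro u hu hc
      have := (hK u hu).2
      rcases this with h | h | h | h
      · omega
      · have := hst0 u h.2; omega
      · omega
      · omega
    unfold cnt
    apply cardsum
    · intro u
      unfold gx
      by_cases hu : col u = 3
      · rw [if_pos hu]
        have : ¬ x b u = 1 := fun h => hc3 u h hu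
        have hh : bD u = b → G.Adj b u := fun h => by rw [← h]; exact (hbD u hu).1.symm
        by_cases h : bD u = b <;> simp [h, this, hu, hh]
      · rw [if_neg hu]
        by_cases h : x b u = 1
        · simp [h, (hK u h).1]
        · simp [h, hu]
    · intro u hu hc
      exact hc3 u hu hc.1
  have ca : ∀ x : V → V → ZMod 2, (∀ a b, x a b = x b a) →
      (∀ a b, ¬ (K0 G col st).Adj a b → x a b = 0) → ∀ a, st a →
      ((cnt G (fun a b => gx col bD x b a) 2 a : ℕ) : ZMod 2) = ∑ y, x a y := by
    intro x hs hx a ha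
    have hK : ∀ u, x a u = 1 → (K0 G col st).Adj a u := by
      intro u hu; by_contra hc; rw [hx a u hc] at hu; exact absurd hu (by decide)
    have ha0 := hst0 a ha
    unfold cnt
    rw [cardsum (x a) _ (fun _ => False)]
    · simp
    · intro u
      unfold gx
      beta_reduce
      rw [if_neg (by omega), hs u a]
      by_cases h : x a u = 1
      · simp [h, (hK u h).1]
      · simp [h]
    · simp
  have cc : ∀ x : V → V → ZMod 2, (∀ a b, x a b = x b a) →
      (∀ a b, ¬ (K0 G col st).Adj a b → x a b = 0) → ∀ c, col c = 2 →
      ((cnt G (WW col cD (gx col bD x)) 2 c : ℕ) : ZMod 2) =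
        ∑ y, x c y + ((univ.filter fun d => col d = 3 ∧ cD d = c).card : ℕ) := by
    intro x hs hx c hc
    have hK : ∀ u, x c u = 1 → G.Adj c u ∧ col u = 1 := by
      intro u hu; by_contra hcc
      rw [hx c u ?_] at hu; exact absurd hu (by decide)
      intro hk
      refine hcc ⟨hk.1, ?_⟩
      rcases hk.2 with h | h | h | h
      · have := hst0 c h.1; omega
      · omega
      · omega
      · exact h.2
    unfold cnt
    apply cardsum
    · intro u
      unfold WW
      rw [if_neg (by omega)]
      by_cases hu : col u = 1
      · rw [if_pos hu]
        unfold gx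
        rw [if_neg (by omega), hs u c]
        by_cases h : x c u = 1
        · simp [h, (hK u h).1]
        · simp [h, hu]
      · rw [if_neg hu]
        have hx1 : ¬ x c u = 1 := fun h => hu (hK u h).2
        unfold qq
        by_cases hu0 : col u = 0
        · simp [hu0, hx1]
        · rw [if_neg (by omega)]
          by_cases h : col u = 3 ∧ cD u = c
          · have := (hcD u h.1).1
            rw [h.2] at this
            simp [h, this.symm]
          · simp only [h, hx1, hc]
            simp
    · intro u hu h
      have := (hK u hu).2
      omega
  -- roots
  let rt : (K0 G col st).ConnectedComponent → V := fun C =>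
    if h : ∃ b, col b = 1 ∧ (K0 G col st).connectedComponentMk b = C then h.choose else C.out
  have hrt : ∀ C, (K0 G col st).connectedComponentMk (rt C) = C := by
    intro C
    by_cases h : ∃ b, col b = 1 ∧ (K0 G col st).connectedComponentMk b = C
    · simp only [rt, dif_pos h]; exact h.choose_spec.2
    · simp only [rt, dif_neg h]; exact Quot.out_eq C
  have hrt1 : ∀ C b, col b = 1 → (K0 G col st).connectedComponentMk b = C → col (rt C) = 1 := by
    intro C b hb hC
    have h : ∃ b, col b = 1 ∧ (K0 G col st).connectedComponentMk b = C := ⟨b, hb, hC⟩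
    simp only [rt, dif_pos h]; exact h.choose_spec.1
  let r : V → V := fun v => rt ((K0 G col st).connectedComponentMk v)
  have hr : ∀ v, (K0 G col st).Reachable v (r v) := by
    intro v
    exact SimpleGraph.ConnectedComponent.eq.1 (hrt _).symm
  have hrr : ∀ v w, r v = w → r w = w := by
    intro v w h
    have h1 := hrt ((K0 G col st).connectedComponentMk v)
    change (K0 G col st).connectedComponentMk (r v) = _ at h1
    rw [h] at h1
    change rt _ = w
    rw [h1]; exact h
  have hnr : ∀ v b, col v ≠ 1 → col b = 1 → (K0 G col st).Adj v b → ∀ y, r y ≠ v := by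
    intro v b hv hb hvb y hy
    have h1 := hrr y v hy
    have h2 := hrt1 ((K0 G col st).connectedComponentMk v) b hb
      (SimpleGraph.ConnectedComponent.eq.2 hvb.symm.reachable)
    change col (r v) = 1 at h2
    rw [h1] at h2
    exact hv h2
  let τ : V → ZMod 2 := fun v => if col v = 0 then 1 else if col v = 1 then
      ((univ.filter fun d => col d = 3 ∧ bD d = v).card : ℕ) else
      1 + ((univ.filter fun d => col d = 3 ∧ cD d = v).card : ℕ)
  obtain ⟨x, hxs, hxK, hxτ⟩ := tjoin (K0 G col st) τ r hr
  have hva : ∀ y : V → V → ZMod 2, ∀ b v, gx col bD y b v = 1 ∨ gx col bD y b v = 2 := by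
    intro y b v; unfold gx; split_ifs <;> simp
  have hAa : ∀ a, st a → (∃ b, G.Adj a b) → ∑ y, x a y = 1 := by
    rintro a ha ⟨b, hab⟩
    have ha0 := hst0 a ha
    rw [hxτ a (hnr a b (by omega) (hst a b ha hab) ⟨hab, Or.inl ⟨ha, hst a b ha hab⟩⟩)]
    simp [τ, ha0]
  have hw : ∀ b, col b = 1 → Odd (cnt G (gx col bD x) 2 b) → r b = b := by
    intro b hb ho
    by_contra hc
    have h1 := hxτ b (fun v hv => hc (hrr v b hv))
    have h2 := cb x hxK b hb
    rw [h1] at h2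
    simp only [τ, hb] at h2
    rw [odd1, h2] at ho
    simp [two] at ho
  refine ⟨gx col bD x, hva x, ?_, ?_, ?_, ?_, ?_, ?_⟩
  · intro b v hb hbv hv hs
    unfold gx
    rw [if_neg (by omega), hxK b v, if_neg (by decide)]
    intro hk
    rcases hk.2 with h | h | h | h
    · have := hst0 b h.1; omega
    · exact hs h.2
    · omega
    · omega
  · intro b d hd
    unfold gx
    rw [if_pos hd]
    split_ifs with h <;> simp [h]
  · intro c hc
    obtain ⟨u, hu, hu1⟩ := hB c hc
    rw [odd1, cc x hxs hxK c hc,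
      hxτ c (hnr c u (by omega) hu1 ⟨hu, Or.inr (Or.inr (Or.inr ⟨hc, hu1⟩))⟩)]
    simp only [τ, hc]
    norm_num
    rw [add_assoc, two, add_zero]
  · intro a ha hab
    rw [odd1, ca x hxs hxK a ha, hAa a ha hab]
  · intro s s' hs hs' ho ho' hreach
    rw [← hw s hs ho, ← hw s' hs' ho']
    change rt _ = rt _
    rw [SimpleGraph.ConnectedComponent.eq.2 hreach]
  · intro s hs ho b0 hreach hb0
    obtain ⟨P, hPs, hPH, hPd⟩ := path (H0 G col st) hreach
    have hPK : ∀ a b, ¬ (K0 G col st).Adj a b → P a b = 0 := fun a b h =>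
      hPH a b (fun h' => h (H0_le_K0 G col st h'))
    have hys : ∀ a b, (fun a b => x a b + P a b) a b = (fun a b => x a b + P a b) b a := by
      intro a b; simp only; rw [hxs, hPs]
    have hyK : ∀ a b, ¬ (K0 G col st).Adj a b → (fun a b => x a b + P a b) a b = 0 := by
      intro a b h; simp only; rw [hxK a b h, hPK a b h, add_zero]
    refine ⟨gx col bD (fun a b => x a b + P a b), hva _, ?_, ?_, ?_⟩
    · intro b v hbc hv
      unfold gx
      by_cases h3 : col v = 3
      · simp [h3]
      · by_cases hH : (H0 G col st).Adj b v
        · rcases hH.2 with h | h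
          · have hb0 := hst0 b h.1
            omega
          · exact absurd h.2 hv
        · simp [h3, hPH b v hH]
    · intro b hb hb1
      have h1 := cb _ hyK b hb1
      simp only [Finset.sum_add_distrib, hPd] at h1
      have h2 := cb x hxK b hb1
      have h3 : ((cnt G (gx col bD x) 2 b : ℕ) : ZMod 2) = if b = s then 1 else 0 := by
        by_cases hbs : b = s
        · rw [if_pos hbs, hbs]; exact (odd1 _).1 ho
        · rw [if_neg hbs, ← z01]
          intro hc
          have hc' := (odd1 _).2 hc
          apply hbs
          rw [← hw s hs ho, ← hw b hb1 hc']
          change rt _ = rt _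
          rw [SimpleGraph.ConnectedComponent.eq.2 (hb.mono (H0_le_K0 G col st))]
      have h4 : ((cnt G (gx col bD fun a b => x a b + P a b) 2 b : ℕ) : ZMod 2) =
          if b = b0 then 1 else 0 := by
        rw [h1]
        rw [h2] at h3
        linear_combination h3 + two (if b = s then 1 else 0)
      rw [odd1, h4]
      by_cases hbb : b = b0 <;> simp [hbb]
    · intro a ha hsa hab
      have ha0 := hst0 a hsa
      rw [odd1, ca _ hys hyK a hsa]
      simp only [Finset.sum_add_distrib, hPd, hAa a hsa hab]
      rw [if_neg (by rintro rfl; omega), if_neg (by rintro rfl; omega)]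
      simp

open Classical in
theorem core {V : Type*} [Fintype V] (G : SimpleGraph V) (hc : G.Colorable 4)
    (hnice : ∀ u v, G.Adj u v → (∃ y, y ≠ v ∧ G.Adj u y) ∨ (∃ y, y ≠ u ∧ G.Adj v y)) :
    ∃ w : V → V → ℕ, (∀ u v, G.Adj u v → w u v = w v u) ∧
      (∀ u v, G.Adj u v → w u v = 1 ∨ w u v = 2 ∨ w u v = 3) ∧
      ∀ u v, G.Adj u v → cnt G w 2 u = cnt G w 2 v → cnt G w 3 u = cnt G w 3 v → False := by
  obtain ⟨col, hp, h4, hgr⟩ := greedy G hc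
  let st : V → Prop := fun a => col a = 0 ∧ ∀ u, G.Adj a u → col u = 1
  have hst0 : ∀ a, st a → col a = 0 := fun a h => h.1
  have hst : ∀ a u, st a → G.Adj a u → col u = 1 := fun a u h => h.2 u
  have hbD : ∀ d, ∃ b, col d = 3 → G.Adj d b ∧ col b = 1 := by
    intro d
    by_cases hd : col d = 3
    · obtain ⟨b, hb⟩ := hgr d 1 (by omega)
      exact ⟨b, fun _ => hb⟩
    · exact ⟨d, fun h => absurd h hd⟩
  have hcD : ∀ d, ∃ b, col d = 3 → G.Adj d b ∧ col b = 2 := by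
    intro d
    by_cases hd : col d = 3
    · obtain ⟨b, hb⟩ := hgr d 2 (by omega)
      exact ⟨b, fun _ => hb⟩
    · exact ⟨d, fun h => absurd h hd⟩
  choose bD hbD using hbD
  choose cD hcD using hcD
  obtain ⟨g0, hg0, hA1, hgD, hgC, hgA, huni, hre⟩ := base G col st hst0 hst
    (fun c hc => hgr c 1 (by omega)) bD cD hbD hcD
  let wr : V → Prop := fun r => col r = 1 ∧ Odd (cnt G g0 2 r)
  let β : V → ℕ := fun c => (univ.filter fun u => G.Adj c u ∧ col u = 0).card
  have hH : ∀ a b, st a → G.Adj a b → (H0 G col st).Adj a b := fun a b ha hab =>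
    ⟨hab, Or.inl ⟨ha, hst a b ha hab⟩⟩
  have hfix := fun (r : V) (h : wr r) => fix G col st hst0 hst (fun b hb => hgr b 0 (by omega)) hnice g0
    {v | (H0 G col st).Reachable r v}
    (fun a b ha hsa hab => SimpleGraph.Reachable.trans ha (hH a b hsa hab).reachable)
    hg0 hA1 (fun b0 hb0 hb01 => hre r h.1 h.2 b0 hb0 hb01) β
  choose! gf f1 f2 f3 f4 f5 using hfix
  simp only [Set.mem_ofPred_eq] at f2 f3 f4 f5
  let g : V → V → ℕ := fun b v => if h : ∃ r, wr r ∧ (H0 G col st).Reachable r b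
    then gf h.choose b v else g0 b v
  have gN : ∀ b v, (¬ ∃ r, wr r ∧ (H0 G col st).Reachable r b) → g b v = g0 b v :=
    fun b v h => dif_neg h
  have gY : ∀ r b v, wr r → (H0 G col st).Reachable r b → g b v = gf r b v := by
    intro r b v hr hrb
    have h : ∃ r, wr r ∧ (H0 G col st).Reachable r b := ⟨r, hr, hrb⟩
    have e : h.choose = r := by
      obtain ⟨k1, k2⟩ := h.choose_spec
      exact huni _ _ k1.1 hr.1 k1.2 hr.2 ((k2.trans hrb.symm).mono (H0_le_K0 G col st))
    simp only [g, dif_pos h, e]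
  have gval : ∀ b v, g b v = 1 ∨ g b v = 2 ∨ g b v = 3 := by
    intro b v
    by_cases h : ∃ r, wr r ∧ (H0 G col st).Reachable r b
    · obtain ⟨r, h1, h2⟩ := h
      rw [gY r b v h1 h2]; exact f1 r h1 b v
    · rw [gN b v h]; have := hg0 b v; omega
  have g1 : ∀ b v, col b = 1 → G.Adj b v → 2 ≤ col v → (g b v = 2 ↔ g0 b v = 2) := by
    intro b v hb hbv hv
    by_cases h : ∃ r, wr r ∧ (H0 G col st).Reachable r b
    · obtain ⟨r, h1, h2⟩ := h
      rw [gY r b v h1 h2]; exact f2 r h1 b v h2 hb hbv hv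
    · rw [gN b v h]
  have g2 : ∀ b v, col b = 1 → G.Adj b v → col v = 0 → ¬ st v → g b v ≠ 2 := by
    intro b v hb hbv hv hs
    by_cases h : ∃ r, wr r ∧ (H0 G col st).Reachable r b
    · obtain ⟨r, h1, h2⟩ := h
      rw [gY r b v h1 h2]; exact f3 r h1 b v h2 hb hbv hv hs
    · rw [gN b v h, hA1 b v hb hbv hv hs]; omega
  let w := WW col cD g
  have wB : ∀ b v, col b = 1 → w b v = g b v := fun b v hb => if_pos hb
  have wB' : ∀ v b, col v ≠ 1 → col b = 1 → w v b = g b v := fun v b hv hb => by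
    simp only [w, WW, if_neg hv, if_pos hb]
  have wq : ∀ u v, col u ≠ 1 → col v ≠ 1 → w u v = qq col cD u v := fun u v hu hv => by
    simp only [w, WW, if_neg hu, if_neg hv]
  have q0 : ∀ u v, col u = 0 ∨ col v = 0 → qq col cD u v = 3 := fun u v h => if_pos h
  have qs : ∀ u v, qq col cD u v = qq col cD v u := by
    intro u v
    unfold qq
    split_ifs <;> first | rfl | (exfalso; tauto)
  have qv : ∀ u v, qq col cD u v = 1 ∨ qq col cD u v = 2 ∨ qq col cD u v = 3 := by
    intro u v; unfold qq; split_ifs <;> simp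
  have q3 : ∀ u v, col u ≠ 0 → col v ≠ 0 → qq col cD u v ≠ 3 := by
    intro u v h1 h2; unfold qq
    rw [if_neg (by omega)]; split_ifs <;> omega
  have cB : ∀ b i, col b = 1 → cnt G w i b = cnt G g i b := fun b i hb =>
    cnt_congr _ _ _ _ _ _ fun u _ => by rw [wB b u hb]
  have cA : ∀ a i, st a → cnt G w i a = cnt G (fun a b => g b a) i a := fun a i ha =>
    cnt_congr _ _ _ _ _ _ fun u hu => by
      rw [wB' a u (by have := hst0 a ha; omega) (hst a u ha hu)]
  have cBY : ∀ r b i, wr r → (H0 G col st).Reachable r b → cnt G g i b = cnt G (gf r) i b :=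
    fun r b i hr hrb => cnt_congr _ _ _ _ _ _ fun u _ => by rw [gY r b u hr hrb]
  have cAY : ∀ r a i, wr r → (H0 G col st).Reachable r a → st a →
      cnt G (fun a b => g b a) i a = cnt G (fun a b => gf r b a) i a :=
    fun r a i hr hrb hsa => cnt_congr _ _ _ _ _ _ fun u hu => by
      rw [gY r u a hr (hrb.trans (hH a u hsa hu).reachable)]
  -- classes
  have kC2 : ∀ c, col c = 2 → Odd (cnt G w 2 c) := by
    intro c hc
    have := hgC c hc
    rw [cnt_congr G w (WW col cD g0) 2 2 c]
    · exact this
    · intro u hu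
      simp only [w, WW]
      have hc1 : ¬ col c = 1 := by omega
      rw [if_neg hc1, if_neg hc1]
      by_cases hu1 : col u = 1
      · rw [if_pos hu1, if_pos hu1]; exact g1 u c hu1 hu.symm (by omega)
      · rw [if_neg hu1, if_neg hu1]
  have k3 : ∀ c, 2 ≤ col c → 1 ≤ cnt G w 3 c := by
    intro c hc
    obtain ⟨u, hu, hu0⟩ := hgr c 0 (by omega)
    exact cnt_pos G w 3 c u hu (by rw [wq c u (by omega) (by omega), q0 _ _ (Or.inr hu0)])
  have kD2 : ∀ d, col d = 3 → cnt G w 2 d = 2 := by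
    intro d hd
    obtain ⟨h1, h2⟩ := hbD d hd
    obtain ⟨h3, h4'⟩ := hcD d hd
    have hne : bD d ≠ cD d := fun h => by rw [h] at h2; omega
    unfold cnt
    rw [Finset.card_eq_two]
    refine ⟨bD d, cD d, hne, ?_⟩
    ext u
    simp only [mem_filter, mem_univ, true_and, mem_insert, mem_singleton]
    constructor
    · rintro ⟨hu, hw⟩
      by_cases hu1 : col u = 1
      · rw [wB' d u (by omega) hu1, g1 u d hu1 hu.symm (by omega), hgD u d hd] at hw
        exact Or.inl hw.symm
      · rw [wq d u (by omega) hu1] at hw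
        right
        have hne3 := hp d u hu
        unfold qq at hw
        split_ifs at hw with k1 k2
        · omega
        · rcases k2 with k2 | k2
          · exact k2.2.symm
          · omega
        · omega
    · rintro (rfl | rfl)
      · refine ⟨h1, ?_⟩
        rw [wB' d _ (by omega) h2, g1 _ d h2 h1.symm (by omega), hgD _ d hd]
      · refine ⟨h3, ?_⟩
        rw [wq d _ (by omega) (by omega)]
        unfold qq
        rw [if_neg (by omega), if_pos (Or.inl ⟨hd, rfl⟩)]
  have kA2 : ∀ a, col a = 0 → ¬ st a → cnt G w 2 a = 0 := by
    intro a ha hs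
    rw [cnt_eq_zero]
    intro u hu
    by_cases hu1 : col u = 1
    · rw [wB' a u (by omega) hu1]; exact g2 u a hu1 hu.symm ha hs
    · rw [wq a u (by omega) hu1, q0 _ _ (Or.inl ha)]; omega
  have kA3 : ∀ a, col a = 0 → ¬ st a → 1 ≤ cnt G w 3 a := by
    intro a ha hs
    have : ∃ u, G.Adj a u ∧ col u ≠ 1 := by
      by_contra hcc
      push Not at hcc
      exact hs ⟨ha, hcc⟩
    obtain ⟨u, hu, hu1⟩ := this
    exact cnt_pos G w 3 a u hu (by rw [wq a u (by omega) hu1, q0 _ _ (Or.inl ha)])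
  have kC3 : ∀ r b c, wr r → (H0 G col st).Reachable r b → col b = 1 → G.Adj b c → col c = 2 →
      cnt G w 3 c = β c + (univ.filter fun b' => G.Adj c b' ∧ (H0 G col st).Reachable r b' ∧
        col b' = 1 ∧ gf r b' c = 3).card := by
    intro r b c hr hrb hb hbc hc
    have hKa : ∀ b', col b' = 1 → G.Adj c b' → (K0 G col st).Adj c b' := fun b' hb' h =>
      ⟨h, Or.inr (Or.inr (Or.inr ⟨hc, hb'⟩))⟩
    simp only [β]
    rw [← card_union_of_disjoint]
    · unfold cnt
      congr 1
      ext u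
      simp only [mem_filter, mem_univ, true_and, mem_union]
      constructor
      · rintro ⟨hu, hw⟩
        by_cases hu0 : col u = 0
        · exact Or.inl ⟨hu, hu0⟩
        · right
          by_cases hu1 : col u = 1
          · rw [wB' c u (by omega) hu1] at hw
            by_cases h : ∃ r, wr r ∧ (H0 G col st).Reachable r u
            · obtain ⟨r', k1, k2⟩ := h
              have : r' = r := by
                refine huni _ _ k1.1 hr.1 k1.2 hr.2 ?_
                have e1 := k2.mono (H0_le_K0 G col st)
                have e2 := hrb.mono (H0_le_K0 G col st)
                exact (e1.trans (hKa u hu1 hu).symm.reachable).trans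
                  ((hKa b hb hbc.symm).reachable.trans e2.symm)
              subst this
              rw [gY r' u c k1 k2] at hw
              exact ⟨hu, k2, hu1, hw⟩
            · rw [gN u c h] at hw
              have := hg0 u c; omega
          · rw [wq c u (by omega) hu1] at hw
            exact absurd hw (q3 c u (by omega) hu0)
      · rintro (⟨hu, hu0⟩ | ⟨hu, hru, hu1, hw⟩)
        · exact ⟨hu, by rw [wq c u (by omega) (by omega), q0 _ _ (Or.inr hu0)]⟩
        · exact ⟨hu, by rw [wB' c u (by omega) hu1, gY r u c hr hru, hw]⟩
    · rw [Finset.disjoint_filter]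
      rintro u _ ⟨_, h1⟩ ⟨_, _, h2, _⟩
      omega
  have kB : ∀ b, col b = 1 → cnt G w 3 b = 0 ∨
      (cnt G w 2 b = 0 ∧ ∀ v, G.Adj b v → col v = 0 → st v) ∨
      (Odd (cnt G w 2 b) ∧ ∀ c, G.Adj b c → col c = 2 → cnt G w 3 b ≠ cnt G w 3 c) := by
    intro b hb
    rw [cB b 3 hb, cB b 2 hb]
    by_cases h : ∃ r, wr r ∧ (H0 G col st).Reachable r b
    · obtain ⟨r, h1, h2⟩ := h
      rw [cBY r b 3 h1 h2, cBY r b 2 h1 h2]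
      rcases f4 r h1 b h2 hb with k | k | ⟨k, k'⟩
      · exact Or.inl k
      · exact Or.inr (Or.inl k)
      · refine Or.inr (Or.inr ⟨k, ?_⟩)
        intro c hbc hc
        rw [kC3 r b c h1 h2 hb hbc hc]
        exact k' c hbc hc
    · left
      rw [cnt_eq_zero]
      intro u _
      rw [gN b u h]; have := hg0 b u; omega
  have kS : ∀ a b, st a → G.Adj a b → cnt G w 2 a = cnt G w 2 b → cnt G w 3 a = cnt G w 3 b →
      False := by
    intro a b ha hab
    have hb := hst a b ha hab
    rw [cA a 2 ha, cA a 3 ha, cB b 2 hb, cB b 3 hb]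
    by_cases h : ∃ r, wr r ∧ (H0 G col st).Reachable r b
    · obtain ⟨r, h1, h2⟩ := h
      have h3 : (H0 G col st).Reachable r a := h2.trans (hH a b ha hab).symm.reachable
      rw [cBY r b 3 h1 h2, cBY r b 2 h1 h2, cAY r a 2 h1 h3 ha, cAY r a 3 h1 h3 ha]
      exact f5 r h1 a b h3 ha hab
    · intro e2 _
      have h1 := hgA a ha ⟨b, hab⟩
      have h2 : cnt G (fun a b => g b a) 2 a = cnt G (fun a b => g0 b a) 2 a := by
        refine cnt_congr _ _ _ _ _ _ fun u hu => ?_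
        rw [gN u a]
        rintro ⟨r, k1, k2⟩
        exact h ⟨r, k1, (k2.trans (hH a u ha hu).symm.reachable).trans (hH a b ha hab).reachable⟩
      have h3 : cnt G g 2 b = cnt G g0 2 b :=
        cnt_congr _ _ _ _ _ _ fun u _ => by rw [gN b u h]
      rw [← h2, e2, h3] at h1
      exact h ⟨b, ⟨hb, h1⟩, SimpleGraph.Reachable.refl b⟩
  have main : ∀ u v, G.Adj u v → col u < col v → cnt G w 2 u = cnt G w 2 v →
      cnt G w 3 u = cnt G w 3 v → False := by
    intro u v huv hlt e2 e3
    have hv4 := h4 v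
    by_cases hu0 : col u = 0
    · by_cases hs : st u
      · exact kS u v hs huv e2 e3
      · have a2 := kA2 u hu0 hs
        have a3 := kA3 u hu0 hs
        by_cases hv1 : col v = 1
        · rcases kB v hv1 with k | k | k
          · omega
          · exact hs (k.2 u huv.symm hu0)
          · obtain ⟨m, hm⟩ := k.1; omega
        · by_cases hv2 : col v = 2
          · obtain ⟨m, hm⟩ := kC2 v hv2; omega
          · have := kD2 v (by omega); omega
    · by_cases hu1 : col u = 1
      · have v3 := k3 v (by omega)
        have v2 : cnt G w 2 v ≠ 0 := by
          by_cases hv2 : col v = 2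
          · obtain ⟨m, hm⟩ := kC2 v hv2; omega
          · have := kD2 v (by omega); omega
        rcases kB u hu1 with k | k | k
        · omega
        · omega
        · by_cases hv2 : col v = 2
          · exact k.2 v huv hv2 e3
          · have := kD2 v (by omega)
            obtain ⟨m, hm⟩ := k.1; omega
      · obtain ⟨m, hm⟩ := kC2 u (by omega)
        have := kD2 v (by omega); omega
  refine ⟨w, ?_, ?_, ?_⟩
  · intro u v huv
    have hne := hp u v huv
    by_cases hu : col u = 1
    · rw [wB u v hu, wB' v u (by omega) hu]
    · by_cases hv : col v = 1
      · rw [wB v u hv, wB' u v hu hv]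
      · rw [wq u v hu hv, wq v u hv hu, qs]
  · intro u v _
    by_cases hu : col u = 1
    · rw [wB u v hu]; exact gval u v
    · by_cases hv : col v = 1
      · rw [wB' u v hu hv]; exact gval v u
      · rw [wq u v hu hv]; exact qv u v
  · intro u v huv e2 e3
    rcases lt_or_gt_of_ne (hp u v huv) with hlt | hlt
    · exact main u v huv hlt e2 e3
    · exact main v u huv.symm hlt e2.symm e3.symm

end Mult

/-- If `G` is a finite simple graph with chromatic number exactly `4` and no connected
component of `G` is isomorphic to `K₂` (equivalently, no edge joins two vertices of
degree `1`), then `G` admits a `3`-labelling of its edges that is p-proper: adjacent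
vertices get distinct products of incident labels. -/
theorem stmt_0 {V : Type*} [Fintype V] [DecidableEq V] (G : SimpleGraph V)
    [DecidableRel G.Adj]
    (hchrom : G.chromaticNumber = 4)
    (hnice : ¬ ∃ u v : V, G.Adj u v ∧ G.degree u = 1 ∧ G.degree v = 1) :
    ∃ ℓ : Sym2 V → ℕ,
      (∀ e ∈ G.edgeSet, ℓ e ∈ ({1, 2, 3} : Set ℕ)) ∧
      ∀ u v : V, G.Adj u v → vertexProd G ℓ u ≠ vertexProd G ℓ v := by
  have hc : G.Colorable 4 :=
    SimpleGraph.chromaticNumber_le_iff_colorable.1 (le_of_eq hchrom)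
  have hdeg : ∀ u v, G.Adj u v → (¬ ∃ y, y ≠ v ∧ G.Adj u y) → G.degree u = 1 := by
    intro u v huv hno
    rw [← SimpleGraph.card_neighborFinset_eq_degree, Finset.card_eq_one]
    refine ⟨v, ?_⟩
    ext y
    simp only [SimpleGraph.mem_neighborFinset, Finset.mem_singleton]
    constructor
    · intro hy
      by_contra hne
      exact hno ⟨y, hne, hy⟩
    · rintro rfl
      exact huv
  obtain ⟨w, h1, h2, h3⟩ := Mult.core G hc (by
    intro u v huv
    by_contra hcon
    rw [not_or] at hcon
    exact hnice ⟨u, v, huv, hdeg u v huv hcon.1, hdeg v u huv.symm hcon.2⟩)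
  exact Mult.finish G w h1 h2 h3
end

section
/- Every finite simple graph G admits an edge labelling ℓ : E(G) → {1,2,3} such that the subgraph of G induced by S_1 has maximum degree at most 1 (i.e., it consists of a possibly empty matching together with isolated vertices), and for every integer x ≠ 1 the set S_x is an independent set of G. -/
open Finset

section Aux
open Classical
universe u
variable {V : Type u} [Fintype V]

/-- Degree of a vertex. -/
noncomputable def dg (T : SimpleGraph V) (v : V) : ℕ := #{w | T.Adj v w}

lemma dg_symmDiff (T P : SimpleGraph V) (v : V) :
    (dg (symmDiff T P) v) % 2 = (dg T v + dg P v) % 2 := by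
  have h : (univ.filter (fun w => (symmDiff T P).Adj v w)) =
      symmDiff (univ.filter (fun w => T.Adj v w)) (univ.filter (fun w => P.Adj v w)) := by
    ext w
    simp [symmDiff]
  have h2 := Finset.card_sdiff_add_card_inter (univ.filter (fun w => T.Adj v w)) (univ.filter (fun w => P.Adj v w))
  have h3 := Finset.card_sdiff_add_card_inter (univ.filter (fun w => P.Adj v w)) (univ.filter (fun w => T.Adj v w))
  rw [Finset.inter_comm] at h3
  unfold dg
  rw [h, symmDiff, Finset.sup_eq_union, Finset.card_union_of_disjoint]
  · omega
  · exact disjoint_sdiff_sdiff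

lemma dg_eq_card (T : SimpleGraph V) (v : V) (s : Finset V) (h : ∀ w, T.Adj v w ↔ w ∈ s) :
    dg T v = #s := by
  unfold dg
  congr 1
  ext w
  simp [h]

lemma dg_edge {a b : V} (hab : a ≠ b) (x : V) :
    dg (SimpleGraph.edge a b) x = (if x = a then 1 else 0) + (if x = b then 1 else 0) := by
  by_cases h1 : x = a
  · subst h1
    rw [dg_eq_card _ _ {b} (by intro w; simp [SimpleGraph.edge_adj]; grind)]
    simp [hab]
  · by_cases h2 : x = b
    · subst h2
      rw [dg_eq_card _ _ {a} (by intro w; simp [SimpleGraph.edge_adj]; grind)]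
      simp [h1]
    · rw [dg_eq_card _ _ ∅ (by intro w; simp [SimpleGraph.edge_adj]; grind)]
      simp [h1, h2]

lemma symmDiff_le_of {K T P : SimpleGraph V} (hT : T ≤ K) (hP : P ≤ K) : symmDiff T P ≤ K :=
  symmDiff_le_sup.trans (sup_le hT hP)

lemma path_join (K : SimpleGraph V) {a b : V} (h : K.Reachable a b) :
    ∃ P ≤ K, ∀ x, (dg P x) % 2 = ((if x = a then 1 else 0) + (if x = b then 1 else 0)) % 2 := by
  obtain ⟨p⟩ := h
  induction p with
  | nil => 
    refine ⟨⊥, bot_le, fun x => ?_⟩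
    simp only [dg]
    split_ifs <;> simp
  | cons hadj p ih =>
    rename_i u v w
    obtain ⟨P, hP, h⟩ := ih
    refine ⟨symmDiff P (SimpleGraph.edge u v), symmDiff_le_of hP ?_, fun x => ?_⟩
    · intro x y hxy
      rw [SimpleGraph.edge_adj] at hxy
      rcases hxy.1 with ⟨rfl, rfl⟩ | ⟨rfl, rfl⟩
      · exact hadj
      · exact hadj.symm
    · rw [dg_symmDiff, dg_edge hadj.ne]
      have := h x
      split_ifs at * <;> omega

/-- parity defect -/
def Wr (X : V → Prop) (u : V → ℕ) (T : SimpleGraph V) (v : V) : Prop :=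
  ((if X v then 0 else u v + 1) + dg T v) % 2 = 1

noncomputable def ex (K : SimpleGraph V) (X : V → Prop) (u : V → ℕ) (T : SimpleGraph V) (v : V) : ℕ :=
  if Wr X u T v then
    (if X v then (if ∃ y, T.Adj v y ∧ u y + dg T y = 1 then 1 else 0)
     else (if (∃ x, K.Adj v x) ∧ u v + dg T v ≠ 0 then 2 else 0))
  else 0

lemma phaseA (K : SimpleGraph V) (X : V → Prop) (hK : ∀ a b, K.Adj a b → (X a ↔ ¬ X b))
    (u : V → ℕ) : ∃ T ≤ K,
      (∀ a b, Wr X u T a → Wr X u T b → K.Reachable a b → a = b) ∧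
      (∀ y, ¬ X y → Wr X u T y → (∃ x, K.Adj y x) → u y + dg T y = 0) ∧
      (∀ x, X x → Wr X u T x → ∀ y, T.Adj x y → u y + dg T y ≠ 1) := by
  obtain ⟨T0, hT0K, hT0⟩ := Finset.exists_min_image (univ.filter (fun T : SimpleGraph V => T ≤ K))
    (fun T => #{v | Wr X u T v}) ⟨⊥, by simp⟩
  obtain ⟨T, hTm, hT⟩ := Finset.exists_min_image
    (univ.filter (fun T : SimpleGraph V => T ≤ K ∧ #{v | Wr X u T v} = #{v | Wr X u T0 v}))
    (fun T => ∑ v, ex K X u T v) ⟨T0, by simpa using hT0K⟩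
  simp only [Finset.mem_filter, Finset.mem_univ, true_and] at hT0K hT0 hTm hT
  obtain ⟨hTK, hTc⟩ := hTm
  have key1 : ∀ a b, Wr X u T a → Wr X u T b → K.Reachable a b → a = b := by
    intro a b ha hb hab
    by_contra hne
    obtain ⟨P, hP, hPd⟩ := path_join K hab
    have := hT0 (symmDiff T P) (symmDiff_le_of hTK hP)
    rw [← hTc] at this
    refine absurd this (not_le.2 (Finset.card_lt_card ?_))
    rw [Finset.ssubset_iff_of_subset]
    · refine ⟨a, by simpa using ha, ?_⟩
      have h1 := hPd a
      have h2 := dg_symmDiff T P a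
      simp only [Finset.mem_filter_univ]
      simp only [Wr] at ha ⊢
      simp only [if_true, if_neg hne] at h1
      omega
    · intro v hv
      have h1 := hPd v
      have h2 := dg_symmDiff T P v
      by_cases hva : v = a
      · subst hva; simpa using ha
      by_cases hvb : v = b
      · subst hvb; simpa using hb
      simp only [Finset.mem_filter_univ] at hv ⊢
      simp only [Wr] at hv ⊢
      simp only [if_neg hva, if_neg hvb] at h1
      omega
  have key2 : ∀ a b, K.Adj a b → Wr X u T a →
      ex K X u T a ≤ ex K X u (symmDiff T (SimpleGraph.edge a b)) b := by
    intro a b hab ha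
    have hne := hab.ne
    set T' := symmDiff T (SimpleGraph.edge a b) with hT'
    have hbr : ¬ Wr X u T b := fun hb => hne (key1 a b ha hb hab.reachable)
    have hadj : ∀ v w, v ≠ a → v ≠ b → (T'.Adj v w ↔ T.Adj v w) := by
      intro v w h1 h2
      simp [hT', symmDiff, SimpleGraph.edge_adj, h1, h2]
    have hdg : ∀ v, v ≠ a → v ≠ b → dg T' v = dg T v := by
      intro v h1 h2
      unfold dg
      simp only [hadj v _ h1 h2]
    have hT'K : T' ≤ K := by
      refine symmDiff_le_of hTK ?_
      intro x y hxy
      rw [SimpleGraph.edge_adj] at hxy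
      rcases hxy.1 with ⟨rfl, rfl⟩ | ⟨rfl, rfl⟩
      · exact hab
      · exact hab.symm
    have hWv : ∀ v, v ≠ a → v ≠ b → (Wr X u T' v ↔ Wr X u T v) := by
      intro v h1 h2
      simp only [Wr, hdg v h1 h2]
    have hWa : ¬ Wr X u T' a := by
      have h2 := dg_symmDiff T (SimpleGraph.edge a b) a
      rw [dg_edge hne, if_pos rfl, if_neg hne, ← hT'] at h2
      simp only [Wr] at ha ⊢
      omega
    have hWb : Wr X u T' b := by
      have h2 := dg_symmDiff T (SimpleGraph.edge a b) b
      rw [dg_edge hne, if_pos rfl, if_neg hne.symm, ← hT'] at h2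
      simp only [Wr] at hbr ⊢
      omega
    have hcard : #{v | Wr X u T' v} = #{v | Wr X u T v} := by
      have e1 : (univ.filter (fun v => Wr X u T' v)) = insert b ((univ.filter (fun v => Wr X u T v)).erase a) := by
        ext v
        by_cases h1 : v = a
        · subst h1; simp [hWa, hne]
        by_cases h2 : v = b
        · subst h2; simp [hWb]
        simp [h1, h2, hWv]
      rw [e1, Finset.card_insert_of_notMem (by simp [hbr]), Finset.card_erase_of_mem (by simpa using ha)]
      have : 0 < #{v | Wr X u T v} := Finset.card_pos.2 ⟨a, by simpa using ha⟩
      omega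
    have hle := hT T' ⟨hT'K, hcard.trans hTc⟩
    have hexv : ∀ v, v ≠ a → v ≠ b → ex K X u T' v = ex K X u T v := by
      intro v h1 h2
      unfold ex
      simp only [hWv v h1 h2]
      by_cases hw : Wr X u T v
      · simp only [hw, if_true, hdg v h1 h2]
        by_cases hX : X v
        · simp only [hX, if_true]
          congr 1
          apply propext
          apply exists_congr
          intro y
          rw [hadj v y h1 h2]
          apply and_congr_right
          intro hvy
          have hya : y ≠ a := by
            rintro rfl
            exact h1 (key1 v y hw ha (hTK hvy).reachable)
          have hyb : y ≠ b := by
            rintro rfl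
            exact h1 (key1 v a hw ha ((hTK hvy).reachable.trans hab.symm.reachable))
          rw [hdg y hya hyb]
        · simp only [hX, if_false]
      · simp [hw]
    rw [← Finset.add_sum_erase univ _ (Finset.mem_univ a),
      ← Finset.add_sum_erase univ _ (Finset.mem_univ a),
      ← Finset.add_sum_erase (univ.erase a) _ (show b ∈ univ.erase a by simp [hne.symm]),
      ← Finset.add_sum_erase (univ.erase a) _ (show b ∈ univ.erase a by simp [hne.symm])] at hle
    have hs : ∑ v ∈ (univ.erase a).erase b, ex K X u T' v = ∑ v ∈ (univ.erase a).erase b, ex K X u T v := by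
      apply Finset.sum_congr rfl
      intro v hv
      simp only [Finset.mem_erase, Finset.mem_univ, and_true] at hv
      exact hexv v hv.2 hv.1
    have e1 : ex K X u T' a = 0 := by simp [ex, hWa]
    have e2 : ex K X u T b = 0 := by simp [ex, hbr]
    omega
  refine ⟨T, hTK, key1, ?_, ?_⟩
  · intro y hy hw ⟨x, hx⟩
    by_contra h0
    have h1 := key2 y x hx hw
    have hXx : X x := by
      by_contra h
      exact hy ((hK y x hx).2 h)
    have e1 : ex K X u T y = 2 := by
      simp only [ex, hw, hy, if_true, if_false]
      rw [if_pos ⟨⟨x, hx⟩, h0⟩]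
    rw [e1] at h1
    simp only [ex, hXx, if_true] at h1
    split_ifs at h1 <;> omega
  · intro x hx hw y hxy h1
    have hk := key2 x y (hTK hxy) hw
    have hy : ¬ X y := (hK x y (hTK hxy)).1 hx
    have e1 : ex K X u T x = 1 := by
      simp only [ex, hw, hx, if_true]
      rw [if_pos ⟨y, hxy, h1⟩]
    have hpos : 0 < dg T y := Finset.card_pos.2 ⟨x, by simpa using hxy.symm⟩
    have hd : dg (symmDiff T (SimpleGraph.edge x y)) y = 0 := by
      have hlt : dg (symmDiff T (SimpleGraph.edge x y)) y < dg T y := by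
        apply Finset.card_lt_card
        rw [Finset.ssubset_iff_of_subset]
        · refine ⟨x, by simpa using hxy.symm, ?_⟩
          simp [symmDiff, SimpleGraph.edge_adj, hxy.symm, hxy.ne.symm]
        · intro w hw
          simp only [symmDiff, SimpleGraph.edge_adj, Finset.mem_filter, Finset.mem_univ, true_and,
            SimpleGraph.sup_adj, SimpleGraph.sdiff_adj] at hw ⊢
          rcases hw with h | ⟨⟨h, _⟩, h2⟩
          · exact h.1
          · rcases h with ⟨rfl, rfl⟩ | ⟨_, rfl⟩
            · exact absurd rfl hxy.ne
            · exact hxy.symm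
      omega
    rw [e1] at hk
    have hu : u y = 0 := by omega
    simp [ex, hy, hd, hu] at hk


lemma dg_pos_of {T : SimpleGraph V} {v w : V} (h : T.Adj v w) : 0 < dg T v :=
  Finset.card_pos.2 ⟨w, by simpa using h⟩

lemma exists_of_dg_pos (T : SimpleGraph V) (v : V) (h : 0 < dg T v) : ∃ w, T.Adj v w := by
  obtain ⟨w, hw⟩ := Finset.card_pos.1 h
  exact ⟨w, by simpa using hw⟩

lemma dg_le_one {T : SimpleGraph V} {v : V} (h : ∀ a b, T.Adj v a → T.Adj v b → a = b) :
    dg T v ≤ 1 := by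
  apply Finset.card_le_one.2
  intro a ha b hb
  simp only [Finset.mem_filter_univ] at ha hb
  exact h a b ha hb

lemma dg_eq_zero {T : SimpleGraph V} {v : V} (h : ∀ a, ¬ T.Adj v a) : dg T v = 0 := by
  rw [dg_eq_card T v ∅ (by simpa using h)]; rfl

lemma phaseB (H : SimpleGraph V) (X : V → Prop) (hH : ∀ a b, H.Adj a b → (X a ↔ ¬ X b))
    (u : V → ℕ) : ∃ E2 E3 : SimpleGraph V, E2 ≤ H ∧ E3 ≤ H ∧ (∀ a b, E2.Adj a b → ¬ E3.Adj a b) ∧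
    ∃ A B : V → ℕ, (∀ v, A v = (if X v then u v else 0) + dg E2 v) ∧
      (∀ v, B v = (if X v then 0 else u v) + dg E3 v) ∧
      (∀ v, A v = 0 ∨ B v = 0 ∨ (A v = 1 ∧ Even (B v))) ∧
      (∀ a b, H.Adj a b → A a = A b → B a = B b → A a = 0 ∧ B a = 0) ∧
      (∀ v a b, H.Adj v a → H.Adj v b → A v = 0 → B v = 0 → A a = 0 → B a = 0 →
        A b = 0 → B b = 0 → a = b) := by
  -- vertices of the first side which already have a positive count
  let U : V → Prop := fun v => X v ∧ 0 < u v
  let K : SimpleGraph V :=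
    { Adj := fun a b => H.Adj a b ∧ ¬ U a ∧ ¬ U b
      symm := ⟨fun a b h => ⟨h.1.symm, h.2.2, h.2.1⟩⟩
      loopless := ⟨fun a h => h.1.ne rfl⟩ }
  have hKH : ∀ a b, K.Adj a b ↔ H.Adj a b ∧ ¬ U a ∧ ¬ U b := fun a b => Iff.rfl
  obtain ⟨T, hTK, h1, h2, h3⟩ := phaseA K X (fun a b h => hH a b h.1) u
  have hTH : ∀ a b, T.Adj a b → H.Adj a b := fun a b h => (hTK h).1
  let W : V → Prop := Wr X u T
  have hWX : ∀ v, X v → (W v ↔ dg T v % 2 = 1) := by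
    intro v hv; simp [W, Wr, hv]
  have hWY : ∀ v, ¬ X v → (W v ↔ (u v + 1 + dg T v) % 2 = 1) := by
    intro v hv; simp [W, Wr, hv]
  let Z : V → Finset V := fun y => univ.filter (fun x => K.Adj y x ∧ dg T x = 0)
  have hZ : ∀ x y, x ∈ Z y ↔ K.Adj y x ∧ dg T x = 0 := by intro x y; simp [Z]
  let st : V → Prop := fun y => ¬ X y ∧ W y ∧ u y + dg T y = 0 ∧ 2 ≤ #(Z y)
  have hσ : ∀ x, ∃ y, (∃ y', st y' ∧ H.Adj x y') → st y ∧ H.Adj x y := by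
    intro x
    by_cases h : ∃ y', st y' ∧ H.Adj x y'
    · obtain ⟨y, hy⟩ := h
      exact ⟨y, fun _ => hy⟩
    · exact ⟨x, fun h' => absurd h' h⟩
  choose σ hσ using hσ
  let S : V → Finset V := fun y => univ.filter (fun x => U x ∧ Even (u x) ∧ H.Adj x y ∧ σ x = y)
  have hS : ∀ x y, x ∈ S y ↔ U x ∧ Even (u x) ∧ H.Adj x y ∧ σ x = y := by intro x y; simp [S]
  have hP : ∀ y, ∃ P : Finset V, st y → P ⊆ Z y ∧ Even (#(S y) + #P) ∧ 2 ≤ #(S y) + #P := by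
    intro y
    by_cases hy : st y
    · by_cases hs : Even #(S y)
      · obtain ⟨P, hP1, hP2⟩ := Finset.exists_subset_card_eq hy.2.2.2
        refine ⟨P, fun _ => ⟨hP1, ?_, by omega⟩⟩
        rw [hP2]; rw [Nat.even_iff] at *; omega
      · obtain ⟨P, hP1, hP2⟩ := Finset.exists_subset_card_eq (show 1 ≤ #(Z y) by have := hy.2.2.2; omega)
        refine ⟨P, fun _ => ⟨hP1, ?_, ?_⟩⟩ <;>
        · rw [hP2]; rw [Nat.even_iff] at *; omega
    · exact ⟨∅, fun h => absurd h hy⟩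
  choose P hP using hP
  let r : V → V → Prop := fun x y => X x ∧ ¬ X y ∧ H.Adj x y ∧
    ((st y ∧ x ∈ S y) ∨ (T.Adj x y ∧ W x) ∨ (st y ∧ x ∈ P y))
  let E2 : SimpleGraph V :=
    { Adj := fun a b => r a b ∨ r b a
      symm := ⟨fun a b h => h.symm⟩
      loopless := ⟨fun a h => by rcases h with h | h <;> exact h.2.1 h.1⟩ }
  let E3 : SimpleGraph V :=
    { Adj := fun a b => T.Adj a b ∧ ¬ (X a ∧ W a) ∧ ¬ (X b ∧ W b)
      symm := ⟨fun a b h => ⟨h.1.symm, h.2.2, h.2.1⟩⟩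
      loopless := ⟨fun a h => h.1.ne rfl⟩ }
  have hE2X : ∀ x y, X x → (E2.Adj x y ↔ r x y) := by
    intro x y hx
    refine ⟨fun h => h.resolve_right (fun h' => h'.2.1 hx), Or.inl⟩
  have hE2Y : ∀ x y, ¬ X y → (E2.Adj y x ↔ r x y) := by
    intro x y hy
    refine ⟨fun h => h.resolve_left (fun h' => hy h'.1), Or.inr⟩
  have hE3 : ∀ a b, E3.Adj a b ↔ T.Adj a b ∧ ¬ (X a ∧ W a) ∧ ¬ (X b ∧ W b) := fun a b => Iff.rfl
  have hTX : ∀ x y, T.Adj x y → X x → ¬ X y := fun x y h hx => (hH x y (hTH x y h)).1 hx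
  have hTY : ∀ x y, T.Adj x y → ¬ X y → X x := fun x y h hy => (hH x y (hTH x y h)).2 hy
  have hTU : ∀ x y, T.Adj x y → ¬ U x := fun x y h => (hTK h).2.1
  have hstT : ∀ y x, st y → ¬ T.Adj y x := by
    intro y x hy h
    have := dg_pos_of h
    have := hy.2.2.1
    omega
  have hPK : ∀ x y, st y → x ∈ P y → K.Adj y x ∧ dg T x = 0 := by
    intro x y hy hx
    exact (hZ x y).1 ((hP y hy).1 hx)
  have hdis : ∀ x y, r x y → ¬ E3.Adj x y := by
    intro x y ⟨hx, hy, hxy, h⟩ h'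
    rcases h with h | h | h
    · exact hstT y x h.1 h'.1.symm
    · exact h'.2.1 ⟨hx, h.2⟩
    · exact hstT y x h.1 h'.1.symm
  let A : V → ℕ := fun v => (if X v then u v else 0) + dg E2 v
  let B : V → ℕ := fun v => (if X v then 0 else u v) + dg E3 v
  have hAX : ∀ v, X v → A v = u v + dg E2 v := by intro v hv; simp [A, hv]
  have hAY : ∀ v, ¬ X v → A v = dg E2 v := by intro v hv; simp [A, hv]
  have hBX : ∀ v, X v → B v = dg E3 v := by intro v hv; simp [B, hv]
  have hBY : ∀ v, ¬ X v → B v = u v + dg E3 v := by intro v hv; simp [B, hv]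
  -- the five kinds of vertices
  have F1 : ∀ x, U x → 1 ≤ A x ∧ B x = 0 ∧ ((∃ y, st y ∧ H.Adj x y) → Odd (A x)) := by
    intro x hx
    have hnT : ∀ y, ¬ T.Adj x y := fun y h => hTU x y h hx
    have hr : ∀ y, r x y → st y ∧ Even (u x) ∧ σ x = y := by
      intro y ⟨_, _, _, h⟩
      rcases h with h | h | h
      · exact ⟨h.1, ((hS x y).1 h.2).2.1, ((hS x y).1 h.2).2.2.2⟩
      · exact absurd h.1 (hnT y)
      · exact absurd hx (hPK x y h.1 h.2).1.2.2
    rw [hAX x hx.1, hBX x hx.1]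
    refine ⟨by have := hx.2; omega, dg_eq_zero (fun y h => hnT y h.1), fun hy => ?_⟩
    have hs := hσ x hy
    by_cases he : Even (u x)
    · have : dg E2 x = #{σ x} := by
        apply dg_eq_card
        intro y
        rw [hE2X x y hx.1, Finset.mem_singleton]
        constructor
        · intro h; exact (hr y h).2.2.symm
        · rintro rfl
          exact ⟨hx.1, hs.1.1, hs.2, Or.inl ⟨hs.1, (hS _ _).2 ⟨hx, he, hs.2, rfl⟩⟩⟩
      rw [this]
      simpa using he.add_one
    · rw [dg_eq_zero (T := E2)]
      · simpa using he
      · intro y h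
        exact he (hr y ((hE2X x y hx.1).1 h)).2.1
  have F2 : ∀ x, X x → ¬ U x → W x → Odd (A x) ∧ B x = 0 := by
    intro x hx hU hW
    have hu : u x = 0 := by
      by_contra h
      exact hU ⟨hx, Nat.pos_of_ne_zero h⟩
    rw [hAX x hx, hBX x hx, hu]
    refine ⟨?_, dg_eq_zero (fun y h => h.2.1 ⟨hx, hW⟩)⟩
    have : dg E2 x = dg T x := by
      apply dg_eq_card
      intro y
      rw [hE2X x y hx, Finset.mem_filter_univ]
      constructor
      · intro ⟨_, _, _, h⟩
        rcases h with h | h | h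
        · exact absurd ((hS x y).1 h.2).1 hU
        · exact h.1
        · have hk := (hPK x y h.1 h.2).1
          have := h1 x y hW h.1.2.1 hk.symm.reachable
          exact absurd hx (this ▸ h.1.1)
      · intro h
        exact ⟨hx, hTX x y h hx, hTH x y h, Or.inr (Or.inl ⟨h, hW⟩)⟩
    rw [this, zero_add, Nat.odd_iff]
    exact (hWX x hx).1 hW
  have F3 : ∀ x, X x → ¬ U x → ¬ W x → (A x = 0 ∧ B x = dg T x ∧ Even (B x)) ∨
      (A x = 1 ∧ B x = 0 ∧ dg T x = 0) := by
    intro x hx hU hW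
    have hu : u x = 0 := by
      by_contra h
      exact hU ⟨hx, Nat.pos_of_ne_zero h⟩
    have hr : ∀ y, r x y → st y ∧ x ∈ P y := by
      intro y ⟨_, _, _, h⟩
      rcases h with h | h | h
      · exact absurd ((hS x y).1 h.2).1 hU
      · exact absurd h.2 hW
      · exact h
    have hle : dg E2 x ≤ 1 := by
      apply dg_le_one
      intro a b ha hb
      rw [hE2X x _ hx] at ha hb
      obtain ⟨ha1, ha2⟩ := hr a ha
      obtain ⟨hb1, hb2⟩ := hr b hb
      exact h1 a b ha1.2.1 hb1.2.1 ((hPK x a ha1 ha2).1.reachable.trans (hPK x b hb1 hb2).1.symm.reachable)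
    have hB : dg E3 x = dg T x := by
      apply dg_eq_card
      intro y
      rw [hE3, Finset.mem_filter_univ]
      exact ⟨fun h => h.1, fun h => ⟨h, fun h' => hW h'.2, fun h' => hTX x y h hx h'.1⟩⟩
    have hev : dg T x % 2 ≠ 1 := fun h => hW ((hWX x hx).2 h)
    rw [hAX x hx, hBX x hx, hu, hB, zero_add]
    rcases Nat.eq_zero_or_pos (dg E2 x) with h0 | h0
    · left
      refine ⟨h0, rfl, ?_⟩
      rw [Nat.even_iff]; omega
    · right
      obtain ⟨y, hy⟩ := exists_of_dg_pos _ _ h0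
      rw [hE2X x y hx] at hy
      obtain ⟨hy1, hy2⟩ := hr y hy
      have := (hPK x y hy1 hy2).2
      exact ⟨by omega, this, this⟩
  have F4 : ∀ y, st y → Even (A y) ∧ 2 ≤ A y ∧ B y = 0 := by
    intro y hy
    have hyX := hy.1
    have hu := hy.2.2.1
    have hB : dg E3 y = 0 := dg_eq_zero (fun x h => hstT y x hy h.1)
    have hA : dg E2 y = #(S y ∪ P y) := by
      apply dg_eq_card
      intro x
      rw [hE2Y x y hyX, Finset.mem_union]
      constructor
      · intro ⟨_, _, _, h⟩
        rcases h with h | h | h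
        · exact Or.inl h.2
        · exact absurd h.1.symm (hstT y x hy)
        · exact Or.inr h.2
      · intro h
        have hxy : H.Adj x y := by
          rcases h with h | h
          · exact ((hS x y).1 h).2.2.1
          · exact (hPK x y hy h).1.1.symm
        refine ⟨(hH x y hxy).2 hyX, hyX, hxy, ?_⟩
        rcases h with h | h
        · exact Or.inl ⟨hy, h⟩
        · exact Or.inr (Or.inr ⟨hy, h⟩)
    rw [Finset.card_union_of_disjoint] at hA
    · rw [hAY y hyX, hBY y hyX, hA, hB]
      exact ⟨(hP y hy).2.1, (hP y hy).2.2, by omega⟩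
    · rw [Finset.disjoint_left]
      intro x hx hx'
      exact (hPK x y hy hx').1.2.2 ((hS x y).1 hx).1
  have F5 : ∀ y, ¬ X y → ¬ st y → (A y = 1 ∧ Even (B y) ∧ 2 ≤ B y) ∨
      (A y = 0 ∧ (Odd (B y) ∨ (∀ x, ¬ K.Adj y x) ∨ (W y ∧ B y = 0 ∧ u y + dg T y = 0))) := by
    intro y hyX hst
    have hr : ∀ x, r x y ↔ T.Adj y x ∧ W x := by
      intro x
      constructor
      · intro ⟨_, _, _, h⟩
        rcases h with h | h | h
        · exact absurd h.1 hst
        · exact ⟨h.1.symm, h.2⟩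
        · exact absurd h.1 hst
      · intro h
        exact ⟨hTY x y h.1.symm hyX, hyX, hTH x y h.1.symm, Or.inr (Or.inl ⟨h.1.symm, h.2⟩)⟩
    have hle : dg E2 y ≤ 1 := by
      apply dg_le_one
      intro a b ha hb
      rw [hE2Y _ y hyX, hr] at ha hb
      exact h1 a b ha.2 hb.2 ((hTK ha.1).symm.reachable.trans (hTK hb.1).reachable)
    have hsum : dg E2 y + dg E3 y = dg T y := by
      unfold dg
      rw [← Finset.card_union_of_disjoint]
      · congr 1
        ext x
        simp only [Finset.mem_union, Finset.mem_filter_univ]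
        rw [hE2Y x y hyX, hr, hE3]
        constructor
        · rintro (h | h)
          · exact h.1
          · exact h.1
        · intro h
          by_cases hW : W x
          · exact Or.inl ⟨h, hW⟩
          · exact Or.inr ⟨h, fun h' => hyX h'.1, fun h' => hW h'.2⟩
      · rw [Finset.disjoint_left]
        intro x hx hx'
        simp only [Finset.mem_filter_univ] at hx hx'
        rw [hE2Y x y hyX] at hx
        exact hdis x y hx hx'.symm
    rw [hAY y hyX, hBY y hyX]
    rcases Nat.eq_zero_or_pos (dg E2 y) with h0 | h0
    · right
      refine ⟨h0, ?_⟩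
      by_cases hW : W y
      · right
        by_cases hK : ∃ x, K.Adj y x
        · right
          have := h2 y hyX hW hK
          exact ⟨hW, by omega, this⟩
        · left
          simpa using hK
      · left
        rw [hWY y hyX] at hW
        rw [Nat.odd_iff]; omega
    · left
      obtain ⟨x, hx⟩ := exists_of_dg_pos _ _ h0
      rw [hE2Y x y hyX, hr] at hx
      have hxX := hTY x y hx.1.symm hyX
      have h3' := h3 x hxX hx.2 y hx.1.symm
      have hWy : ¬ W y := by
        intro hWy
        have := h1 x y hx.2 hWy (hTK hx.1).symm.reachable
        exact hyX (this ▸ hxX)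
      rw [hWY y hyX] at hWy
      rw [Nat.even_iff]
      refine ⟨by omega, by omega, by omega⟩
  have key : ∀ x y, X x → ¬ X y → H.Adj x y → A x = A y → B x = B y →
      A x = 0 ∧ B x = 0 ∧ ¬ U x ∧ K.Adj y x ∧ dg T x = 0 ∧ ¬ st y ∧ W y ∧ u y + dg T y = 0 := by
    intro x y hx hy hxy hA hB
    by_cases hU : U x
    · exfalso
      have f1 := F1 x hU
      by_cases hst : st y
      · have f4 := F4 y hst
        have := f1.2.2 ⟨y, hst, hxy⟩
        rw [hA] at this
        exact Nat.not_even_iff_odd.2 this f4.1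
      · have f5 := F5 y hy hst
        omega
    have hUy : ¬ U y := fun h => hy h.1
    by_cases hW : W x
    · exfalso
      have f2 := F2 x hx hU hW
      by_cases hst : st y
      · have hk : K.Adj y x := ⟨hxy.symm, hUy, hU⟩
        have := h1 x y hW hst.2.1 hk.symm.reachable
        exact hy (this ▸ hx)
      · have f5 := F5 y hy hst
        have := f2.1
        rw [Nat.odd_iff] at this
        omega
    have f3 := F3 x hx hU hW
    by_cases hst : st y
    · have f4 := F4 y hst
      omega
    · have f5 := F5 y hy hst
      have hk : K.Adj y x := ⟨hxy.symm, hUy, hU⟩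
      rcases f5 with f5 | ⟨f5, f6 | f6 | f6⟩
      · omega
      · rcases f3 with f3 | f3
        · have := f3.2.2
          rw [hB] at this
          exact absurd f6 (Nat.not_odd_iff_even.2 this)
        · omega
      · exact absurd hk (f6 x)
      · refine ⟨by omega, by omega, hU, hk, by omega, hst, f6.1, f6.2.2⟩
  refine ⟨E2, E3, ?_, ?_, ?_, A, B, fun _ => rfl, fun _ => rfl, ?_, ?_, ?_⟩
  · rintro a b (h | h)
    · exact h.2.2.1
    · exact h.2.2.1.symm
  · intro a b h
    exact hTH a b h.1
  · rintro a b (h | h) h'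
    · exact hdis a b h h'
    · exact hdis b a h h'.symm
  · intro v
    by_cases hX : X v
    · by_cases hU : U v
      · exact Or.inr (Or.inl (F1 v hU).2.1)
      by_cases hW : W v
      · exact Or.inr (Or.inl (F2 v hX hU hW).2)
      rcases F3 v hX hU hW with h | h
      · exact Or.inl h.1
      · exact Or.inr (Or.inl h.2.1)
    · by_cases hst : st v
      · exact Or.inr (Or.inl (F4 v hst).2.2)
      rcases F5 v hX hst with h | h
      · exact Or.inr (Or.inr ⟨h.1, h.2.1⟩)
      · exact Or.inl h.1
  · intro a b hab hA hB
    by_cases hX : X a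
    · have := key a b hX ((hH a b hab).1 hX) hab hA hB
      exact ⟨this.1, this.2.1⟩
    · have hXb : X b := by
        by_contra h
        exact hX ((hH a b hab).2 h)
      have := key b a hXb hX hab.symm hA.symm hB.symm
      exact ⟨hA ▸ this.1, hB ▸ this.2.1⟩
  · intro v a b hva hvb hA hB hAa hBa hAb hBb
    by_cases hX : X v
    · have ka := key v a hX ((hH v a hva).1 hX) hva (by omega) (by omega)
      have kb := key v b hX ((hH v b hvb).1 hX) hvb (by omega) (by omega)
      exact h1 a b ka.2.2.2.2.2.2.1 kb.2.2.2.2.2.2.1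
        (ka.2.2.2.1.reachable.trans kb.2.2.2.1.symm.reachable)
    · have hXa : X a := by
        by_contra h
        exact hX ((hH v a hva).2 h)
      have hXb : X b := by
        by_contra h
        exact hX ((hH v b hvb).2 h)
      have ka := key a v hXa hX hva.symm (by omega) (by omega)
      have kb := key b v hXb hX hvb.symm (by omega) (by omega)
      by_contra hne
      apply ka.2.2.2.2.2.1
      refine ⟨hX, ka.2.2.2.2.2.2.1, ka.2.2.2.2.2.2.2, ?_⟩
      rw [← Finset.card_pair hne]
      apply Finset.card_le_card
      intro x hx
      rw [Finset.mem_insert, Finset.mem_singleton] at hx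
      rw [hZ]
      rcases hx with rfl | rfl
      · exact ⟨ka.2.2.2.1, ka.2.2.2.2.1⟩
      · exact ⟨kb.2.2.2.1, kb.2.2.2.2.1⟩

end Aux

section Aux2
open Classical
universe u
variable {V : Type u} [Fintype V]

lemma greedy (G : SimpleGraph V) : ∃ c : V → ℕ, (∀ a b, G.Adj a b → c a ≠ c b) ∧ (∀ v, 1 ≤ c v) ∧
    (∀ v j, 1 ≤ j → j < c v → ∃ w, G.Adj v w ∧ c w = j) := by
  let P : ℕ → Prop := fun n => ∃ c : V → ℕ, (∀ a b, G.Adj a b → c a ≠ c b) ∧ (∀ v, 1 ≤ c v) ∧ ∑ v, c v = n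
  have hP : ∃ n, P n := by
    refine ⟨_, fun v => (Fintype.equivFin V v : ℕ) + 1, ?_, ?_, rfl⟩
    · intro a b hab h
      apply hab.ne
      have : (Fintype.equivFin V a : ℕ) = Fintype.equivFin V b := by simpa using h
      exact (Fintype.equivFin V).injective (Fin.ext this)
    · intro v; simp
  obtain ⟨c, hc, hc1, hs⟩ := Nat.find_spec hP
  refine ⟨c, hc, hc1, ?_⟩
  intro v j hj hjv
  by_contra hno
  push Not at hno
  have hlt : ∑ x, Function.update c v j x < ∑ x, c x := by
    apply Finset.sum_lt_sum
    · intro x _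
      by_cases h : x = v
      · subst h; simp; omega
      · simp [h]
    · exact ⟨v, Finset.mem_univ _, by simpa using hjv⟩
  rw [hs] at hlt
  apply Nat.find_min hP hlt
  refine ⟨Function.update c v j, ?_, ?_, rfl⟩
  · intro a b hab
    by_cases h1 : a = v
    · subst h1
      have : b ≠ a := hab.ne.symm
      simp only [Function.update_self, Function.update_of_ne this]
      exact fun h => hno b hab h.symm
    · by_cases h2 : b = v
      · subst h2
        simp only [Function.update_self, Function.update_of_ne h1]
        exact hno a hab.symm
      · simp only [Function.update_of_ne h1, Function.update_of_ne h2]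
        exact hc a b hab
  · intro x
    by_cases h : x = v
    · subst h; simpa using hj
    · simpa [h] using hc1 x

lemma card_opp (c : ℕ) : #((Finset.Ico 1 c).filter (fun j => j % 2 ≠ c % 2)) = c / 2 := by
  induction c using Nat.twoStepInduction with
  | zero => simp
  | one => simp
  | more n ih _ =>
    rcases Nat.eq_zero_or_pos n with rfl | hn
    · decide
    have e : ((Finset.Ico 1 (n+2)).filter (fun j => j % 2 ≠ (n+2) % 2)) =
      insert (n+1) ((Finset.Ico 1 n).filter (fun j => j % 2 ≠ n % 2)) := by
      ext j
      simp only [Finset.mem_filter, Finset.mem_Ico, Finset.mem_insert]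
      omega
    rw [e, Finset.card_insert_of_notMem (by simp), ih]
    omega

lemma colours (c up : ℕ) (hc : 3 ≤ c) : ∃ J ⊆ Finset.Ico 1 c,
    #(J.filter (fun j => j % 2 ≠ c % 2)) = c / 2 ∧
    Odd (c / 2 + c + (up + #(J.filter (fun j => j % 2 = c % 2)))) ∧
    1 ≤ up + #(J.filter (fun j => j % 2 = c % 2)) := by
  have main : ∀ S ⊆ Finset.Ico 1 c, (∀ j ∈ S, j % 2 = c % 2) → Odd (c / 2 + c + (up + #S)) → 1 ≤ up + #S →
      ∃ J ⊆ Finset.Ico 1 c,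
    #(J.filter (fun j => j % 2 ≠ c % 2)) = c / 2 ∧
    Odd (c / 2 + c + (up + #(J.filter (fun j => j % 2 = c % 2)))) ∧
    1 ≤ up + #(J.filter (fun j => j % 2 = c % 2)) := by
    intro S hS hpar h1 h2
    have e1 : ((((Finset.Ico 1 c).filter (fun j => j % 2 ≠ c % 2)) ∪ S).filter (fun j => j % 2 ≠ c % 2)) = 
      ((Finset.Ico 1 c).filter (fun j => j % 2 ≠ c % 2)) := by
      ext j; simp only [Finset.mem_filter, Finset.mem_union]; grind
    have e2 : ((((Finset.Ico 1 c).filter (fun j => j % 2 ≠ c % 2)) ∪ S).filter (fun j => j % 2 = c % 2)) = S := by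
      ext j; simp only [Finset.mem_filter, Finset.mem_union]; grind
    refine ⟨_ ∪ S, Finset.union_subset (Finset.filter_subset _ _) hS, by rw [e1, card_opp], ?_, ?_⟩
    · rw [e2]; exact h1
    · rw [e2]; exact h2
  by_cases hpar : Odd (c / 2 + c + up)
  · by_cases hup : up = 0
    · have h5 : 5 ≤ c := by
        by_contra h
        have : c = 3 ∨ c = 4 := by omega
        rcases this with rfl | rfl <;> subst hup <;> revert hpar <;> decide
      have hcard : #({2 - c % 2, 4 - c % 2} : Finset ℕ) = 2 := by
        rw [Finset.card_pair]; omega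
      refine main {2 - c % 2, 4 - c % 2} ?_ ?_ ?_ ?_
      · intro j; simp only [Finset.mem_insert, Finset.mem_singleton, Finset.mem_Ico]; omega
      · intro j; simp only [Finset.mem_insert, Finset.mem_singleton]; omega
      · rw [hcard]; rw [Nat.odd_iff] at *; omega
      · omega
    · exact main ∅ (by simp) (by simp) (by simpa using hpar) (by simp; omega)
  · refine main {2 - c % 2} ?_ ?_ ?_ ?_
    · intro j; simp only [Finset.mem_singleton, Finset.mem_Ico]; omega
    · intro j; simp only [Finset.mem_singleton]; omega
    · rw [Finset.card_singleton]; rw [Nat.odd_iff] at *; omega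
    · simp

def Spec1 (c : V → ℕ) (M : V → V → Prop) (v : V) : Prop :=
  #{w | M v w ∧ c w % 2 ≠ c v % 2} = c v / 2 ∧
  Odd (c v / 2 + c v + (#{w | M w v} + #{w | M v w ∧ c w % 2 = c v % 2})) ∧
  1 ≤ #{w | M w v} + #{w | M v w ∧ c w % 2 = c v % 2}

lemma choose_marks (G : SimpleGraph V) (c : V → ℕ)
    (hg : ∀ v j, 1 ≤ j → j < c v → ∃ w, G.Adj v w ∧ c w = j) (v : V) (hv : 3 ≤ c v) (up : ℕ) :
    ∃ S : Finset V, (∀ w ∈ S, G.Adj v w ∧ c w < c v) ∧ 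
    #{w | w ∈ S ∧ c w % 2 ≠ c v % 2} = c v / 2 ∧
    Odd (c v / 2 + c v + (up + #{w | w ∈ S ∧ c w % 2 = c v % 2})) ∧
    1 ≤ up + #{w | w ∈ S ∧ c w % 2 = c v % 2} := by
  obtain ⟨J, hJ, h1, h2, h3⟩ := colours (c v) up hv
  have : ∀ j, ∃ w, j ∈ J → G.Adj v w ∧ c w = j := by
    intro j
    by_cases hj : j ∈ J
    · have := hJ hj
      simp only [Finset.mem_Ico] at this
      obtain ⟨w, hw⟩ := hg v j this.1 this.2
      exact ⟨w, fun _ => hw⟩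
    · exact ⟨v, fun h => absurd h hj⟩
  choose n hn using this
  have hc : ∀ p : ℕ → Prop, #{w | w ∈ J.image n ∧ p (c w)} = #(J.filter p) := by
    intro p
    symm
    apply Finset.card_bij (fun j _ => n j)
    · intro j hj
      simp only [Finset.mem_filter] at hj
      simp only [Finset.mem_filter, Finset.mem_univ, true_and]
      refine ⟨Finset.mem_image_of_mem _ hj.1, ?_⟩
      rw [(hn j hj.1).2]; exact hj.2
    · intro i hi j hj hij
      simp only [Finset.mem_filter] at hi hj
      rw [← (hn i hi.1).2, ← (hn j hj.1).2, hij]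
    · intro w hw
      simp only [Finset.mem_filter, Finset.mem_univ, true_and, Finset.mem_image] at hw
      obtain ⟨⟨j, hj, rfl⟩, hp⟩ := hw
      rw [(hn j hj).2] at hp
      exact ⟨j, by simp [hj, hp], rfl⟩
  refine ⟨J.image n, ?_, ?_, ?_, ?_⟩
  · intro w hw
    simp only [Finset.mem_image] at hw
    obtain ⟨j, hj, rfl⟩ := hw
    have := hJ hj
    simp only [Finset.mem_Ico] at this
    exact ⟨(hn j hj).1, by rw [(hn j hj).2]; exact this.2⟩
  · rw [← h1]
    convert hc (fun x => x % 2 ≠ c v % 2)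
  · convert h2
    convert hc (fun x => x % 2 = c v % 2)
  · convert h3
    convert hc (fun x => x % 2 = c v % 2)

lemma phase1 (G : SimpleGraph V) (c : V → ℕ)
    (hg : ∀ v j, 1 ≤ j → j < c v → ∃ w, G.Adj v w ∧ c w = j) :
    ∃ M : V → V → Prop, (∀ v w, M v w → G.Adj v w ∧ c w < c v ∧ 3 ≤ c v) ∧
      ∀ v, 3 ≤ c v → Spec1 c M v := by
  set N := univ.sup c with hN
  have hle : ∀ v, c v ≤ N := fun v => Finset.le_sup (f := c) (Finset.mem_univ v)
  have main : ∀ m, ∃ M : V → V → Prop, (∀ v w, M v w → G.Adj v w ∧ c w < c v ∧ 3 ≤ c v) ∧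
      ∀ v, 3 ≤ c v → N < c v + m → Spec1 c M v := by
    intro m
    induction m with
    | zero =>
      refine ⟨fun _ _ => False, by simp, ?_⟩
      intro v _ h
      have := hle v
      omega
    | succ m ih =>
      obtain ⟨M, hM, hs⟩ := ih
      have : ∀ v, ∃ S : Finset V, 3 ≤ c v → (∀ w ∈ S, G.Adj v w ∧ c w < c v) ∧ 
          #{w | w ∈ S ∧ c w % 2 ≠ c v % 2} = c v / 2 ∧
          Odd (c v / 2 + c v + (#{w | M w v} + #{w | w ∈ S ∧ c w % 2 = c v % 2})) ∧
          1 ≤ #{w | M w v} + #{w | w ∈ S ∧ c w % 2 = c v % 2} := by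
        intro v
        by_cases hv : 3 ≤ c v
        · obtain ⟨S, hS⟩ := choose_marks G c hg v hv #{w | M w v}
          exact ⟨S, fun _ => hS⟩
        · exact ⟨∅, fun h => absurd h hv⟩
      choose S hS using this
      let M' : V → V → Prop := fun v w => if c v + m = N then (3 ≤ c v ∧ w ∈ S v) else M v w
      have hup : ∀ v w, N ≤ c v + m → (M' w v ↔ M w v) := by
        intro v w h
        simp only [M']
        split_ifs with h1
        · constructor
          · intro h2
            have := ((hS w h2.1).1 v h2.2).2
            omega
          · intro h2
            have := (hM w v h2).2.1
            omega
        · rfl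
      refine ⟨M', ?_, ?_⟩
      · intro v w h
        simp only [M'] at h
        split_ifs at h with h1
        · have := (hS v h.1).1 w h.2
          exact ⟨this.1, this.2, h.1⟩
        · exact hM v w h
      · intro v hv h
        by_cases h1 : c v + m = N
        · have e : ∀ w, M' v w ↔ w ∈ S v := by
            intro w; simp [M', h1, hv]
          simp only [Spec1, hup v _ h1.ge, e]
          exact (hS v hv).2
        · have e : ∀ w, M' v w ↔ M v w := by
            intro w; simp [M', h1]
          have := hs v hv (by omega)
          simp only [Spec1, hup v _ (show N ≤ c v + m by omega), e]
          exact this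
  obtain ⟨M, hM, hs⟩ := main N
  exact ⟨M, hM, fun v hv => hs v hv (by omega)⟩

end Aux2

section Aux3
open Classical
universe u
variable {V : Type u} [Fintype V]

/-- Graph of the marked edges whose lower endpoint has a colour of residue `r` modulo `2`. -/
def markGraph (c : V → ℕ) (M : V → V → Prop) (hM : ∀ v w, M v w → c w < c v) (r : ℕ) :
    SimpleGraph V where
  Adj a b := (M a b ∧ c b % 2 = r) ∨ (M b a ∧ c a % 2 = r)
  symm := ⟨fun _ _ h => h.symm⟩
  loopless := ⟨fun a h => by
    rcases h with h | h <;> exact absurd (hM a a h.1) (lt_irrefl _)⟩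

lemma dg_mark_same (c : V → ℕ) (M : V → V → Prop) (hM : ∀ v w, M v w → c w < c v) (r : ℕ)
    (v : V) (hv : c v % 2 = r) :
    dg (markGraph c M hM r) v = #{w | M w v} + #{w | M v w ∧ c w % 2 = c v % 2} := by
  rw [← Finset.card_union_of_disjoint]
  · apply dg_eq_card
    intro w
    rw [Finset.mem_union, Finset.mem_filter_univ, Finset.mem_filter_univ, hv]
    simp only [markGraph]
    tauto
  · rw [Finset.disjoint_left]
    intro w h1 h2
    rw [Finset.mem_filter_univ] at h1 h2
    have := hM _ _ h1
    have := hM _ _ h2.1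
    omega

lemma dg_mark_opp (c : V → ℕ) (M : V → V → Prop) (hM : ∀ v w, M v w → c w < c v) (r : ℕ)
    (hr : r < 2) (v : V) (hv : c v % 2 ≠ r) :
    dg (markGraph c M hM r) v = #{w | M v w ∧ c w % 2 ≠ c v % 2} := by
  apply dg_eq_card
  intro w
  rw [Finset.mem_filter_univ]
  simp only [markGraph]
  constructor
  · rintro (h | h)
    · exact ⟨h.1, by omega⟩
    · exact absurd h.2 hv
  · intro h
    exact Or.inl ⟨h.1, by omega⟩

lemma dg_sup (S T : SimpleGraph V) (h : ∀ a b, S.Adj a b → ¬ T.Adj a b) (v : V) :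
    dg (S ⊔ T) v = dg S v + dg T v := by
  unfold dg
  rw [← Finset.card_union_of_disjoint]
  · apply dg_eq_card
    intro w
    simp
  · rw [Finset.disjoint_left]
    intro w h1 h2
    rw [Finset.mem_filter_univ] at h1 h2
    exact h _ _ h1 h2

lemma dg_zero_of (S : SimpleGraph V) (v : V) (h : ∀ w, ¬ S.Adj v w) : dg S v = 0 := by
  rw [dg_eq_card S v ∅ (by simpa using h), Finset.card_empty]

lemma core (G : SimpleGraph V) : ∃ G2 G3 : SimpleGraph V, G2 ≤ G ∧ G3 ≤ G ∧
    (∀ a b, G2.Adj a b → ¬ G3.Adj a b) ∧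
    (∀ a b, G.Adj a b → dg G2 a = dg G2 b → dg G3 a = dg G3 b → dg G2 a = 0 ∧ dg G3 a = 0) ∧
    (∀ v a b, G.Adj v a → G.Adj v b → dg G2 v = 0 → dg G3 v = 0 → dg G2 a = 0 → dg G3 a = 0 →
      dg G2 b = 0 → dg G3 b = 0 → a = b) := by
  obtain ⟨c, hc, hc1, hg⟩ := greedy G
  obtain ⟨M, hM, hS⟩ := phase1 G c hg
  have hM' : ∀ v w, M v w → c w < c v := fun v w h => (hM v w h).2.1
  let H : SimpleGraph V :=
    { Adj := fun a b => G.Adj a b ∧ c a ≤ 2 ∧ c b ≤ 2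
      symm := ⟨fun a b h => ⟨h.1.symm, h.2.2, h.2.1⟩⟩
      loopless := ⟨fun a h => G.loopless.irrefl a h.1⟩ }
  have hHa : ∀ a b, H.Adj a b ↔ G.Adj a b ∧ c a ≤ 2 ∧ c b ≤ 2 := fun a b => Iff.rfl
  obtain ⟨E2, E3, hE2, hE3, hdis, A, B, hA, hB, hAB, hconf, hzero⟩ :=
    phaseB H (fun v => c v = 1) (by
      intro a b h
      have h1 := hc a b h.1
      have h2 := hc1 a
      have h3 := hc1 b
      have h4 := h.2
      constructor
      · intro h5 h6; omega
      · intro h5; omega) (fun v => if c v ≤ 2 then #{w | M w v} else 0)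
  clear_value H
  have hdM : ∀ (r : ℕ) (E : SimpleGraph V), E ≤ H → ∀ a b, (markGraph c M hM' r).Adj a b → ¬ E.Adj a b := by
    intro r E hE a b h1 h2
    have h3 := ((hHa a b).1 (hE h2)).2
    rcases h1 with h | h
    · have := (hM _ _ h.1).2.2; omega
    · have := (hM _ _ h.1).2.2; omega
  have hMG : ∀ r, markGraph c M hM' r ≤ G := by
    intro r a b h
    rcases h with h | h
    · exact (hM _ _ h.1).1
    · exact (hM _ _ h.1).1.symm
  have hHG : H ≤ G := fun a b h => ((hHa a b).1 h).1
  have hMM : ∀ a b, (markGraph c M hM' 1).Adj a b → ¬ (markGraph c M hM' 0).Adj a b := by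
    intro a b h1 h2
    rcases h1 with h | h <;> rcases h2 with h' | h'
    · omega
    · have := hM' _ _ h.1
      have := hM' _ _ h'.1
      omega
    · have := hM' _ _ h.1
      have := hM' _ _ h'.1
      omega
    · omega
  have d2 : ∀ v, dg (markGraph c M hM' 1 ⊔ E2) v = dg (markGraph c M hM' 1) v + dg E2 v :=
    dg_sup _ _ (hdM 1 E2 hE2)
  have d3 : ∀ v, dg (markGraph c M hM' 0 ⊔ E3) v = dg (markGraph c M hM' 0) v + dg E3 v :=
    dg_sup _ _ (hdM 0 E3 hE3)
  have nodown : ∀ v, c v ≤ 2 → ∀ w, ¬ M v w := by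
    intro v hv w h
    have := (hM _ _ h).2.2
    omega
  have low : ∀ v, c v ≤ 2 → dg (markGraph c M hM' 1 ⊔ E2) v = A v ∧
      dg (markGraph c M hM' 0 ⊔ E3) v = B v := by
    intro v hv
    have e1 : #{w | M v w ∧ c w % 2 = c v % 2} = 0 := by
      rw [Finset.card_eq_zero, Finset.filter_eq_empty_iff]
      exact fun w _ h => nodown v hv w h.1
    have e2 : #{w | M v w ∧ c w % 2 ≠ c v % 2} = 0 := by
      rw [Finset.card_eq_zero, Finset.filter_eq_empty_iff]
      exact fun w _ h => nodown v hv w h.1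
    rw [d2, d3, hA, hB]
    have := hc1 v
    by_cases h1 : c v = 1
    · rw [dg_mark_same c M hM' 1 v (by omega), dg_mark_opp c M hM' 0 (by omega) v (by omega), e1, e2]
      simp only [if_pos h1, if_pos hv]
      simp
    · rw [dg_mark_same c M hM' 0 v (by omega), dg_mark_opp c M hM' 1 (by omega) v (by omega), e1, e2]
      simp only [if_neg h1, if_pos hv]
      simp
  have high : ∀ v, 3 ≤ c v →
      (c v % 2 = 1 ∧ dg (markGraph c M hM' 0 ⊔ E3) v = c v / 2 ∧
        (c v / 2 + c v + dg (markGraph c M hM' 1 ⊔ E2) v) % 2 = 1 ∧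
        1 ≤ dg (markGraph c M hM' 1 ⊔ E2) v) ∨
      (c v % 2 = 0 ∧ dg (markGraph c M hM' 1 ⊔ E2) v = c v / 2 ∧
        (c v / 2 + c v + dg (markGraph c M hM' 0 ⊔ E3) v) % 2 = 1 ∧
        1 ≤ dg (markGraph c M hM' 0 ⊔ E3) v) := by
    intro v hv
    obtain ⟨s1, s2, s3⟩ := hS v hv
    rw [Nat.odd_iff] at s2
    have e2 : dg E2 v = 0 := dg_zero_of _ _ fun w h => by
      have := ((hHa _ _).1 (hE2 h)).2.1; omega
    have e3 : dg E3 v = 0 := dg_zero_of _ _ fun w h => by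
      have := ((hHa _ _).1 (hE3 h)).2.1; omega
    rw [d2, d3, e2, e3]
    rcases Nat.mod_two_eq_zero_or_one (c v) with h | h
    · right
      rw [dg_mark_same c M hM' 0 v (by omega), dg_mark_opp c M hM' 1 (by omega) v (by omega)]
      exact ⟨h, s1, s2, s3⟩
    · left
      rw [dg_mark_same c M hM' 1 v (by omega), dg_mark_opp c M hM' 0 (by omega) v (by omega)]
      exact ⟨h, s1, s2, s3⟩
  have disj : ∀ a b, (markGraph c M hM' 1 ⊔ E2).Adj a b → ¬ (markGraph c M hM' 0 ⊔ E3).Adj a b := by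
    intro a b h1 h2
    rw [SimpleGraph.sup_adj] at h1 h2
    rcases h1 with h1 | h1 <;> rcases h2 with h2 | h2
    · exact hMM _ _ h1 h2
    · exact hdM 1 E3 hE3 _ _ h1 h2
    · exact hdM 0 E2 hE2 _ _ h2 h1
    · exact hdis _ _ h1 h2
  have le2 : markGraph c M hM' 1 ⊔ E2 ≤ G := sup_le (hMG 1) (hE2.trans hHG)
  have le3 : markGraph c M hM' 0 ⊔ E3 ≤ G := sup_le (hMG 0) (hE3.trans hHG)
  refine ⟨_, _, le2, le3, disj, ?_, ?_⟩
  · generalize markGraph c M hM' 1 ⊔ E2 = G2 at *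
    generalize markGraph c M hM' 0 ⊔ E3 = G3 at *
    have mix : ∀ a b, 3 ≤ c a → c b ≤ 2 → dg G2 a = dg G2 b → dg G3 a = dg G3 b → False := by
      intro a b ha hb h2 h3
      have p1 := high a ha
      obtain ⟨q1, q2⟩ := low b hb
      have q3 := hAB b
      rw [Nat.even_iff] at q3
      omega
    intro a b hab h2 h3
    have hne := hc a b hab
    rcases Nat.lt_or_ge 2 (c a) with ha | ha <;> rcases Nat.lt_or_ge 2 (c b) with hb | hb
    · have p1 := high a ha
      have p2 := high b hb
      omega
    · exact (mix a b ha hb h2 h3).elim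
    · exact (mix b a hb ha h2.symm h3.symm).elim
    · have q1 := low a ha
      have q2 := low b hb
      have := hconf a b ((hHa a b).2 ⟨hab, ha, hb⟩) (by omega) (by omega)
      omega
  · generalize markGraph c M hM' 1 ⊔ E2 = G2 at *
    generalize markGraph c M hM' 0 ⊔ E3 = G3 at *
    have z : ∀ v, dg G2 v = 0 → dg G3 v = 0 → c v ≤ 2 ∧ A v = 0 ∧ B v = 0 := by
      intro v h2 h3
      have hv : c v ≤ 2 := by
        by_contra hv
        have p1 := high v (by omega)
        omega
      have := low v hv
      omega
    intro v a b va vb h1 h2 h3 h4 h5 h6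
    obtain ⟨v1, v2, v3⟩ := z v h1 h2
    obtain ⟨a1, a2, a3⟩ := z a h3 h4
    obtain ⟨b1, b2, b3⟩ := z b h5 h6
    exact hzero v a b ((hHa _ _).2 ⟨va, v1, a1⟩) ((hHa _ _).2 ⟨vb, v1, b1⟩) v2 v3 a2 a3 b2 b3

lemma two_three_inj (a b a' b' : ℕ) (h : 2 ^ a * 3 ^ b = 2 ^ a' * 3 ^ b') : a = a' ∧ b = b' := by
  have h2 := congrArg (fun n => n.factorization 2) h
  have h3 := congrArg (fun n => n.factorization 3) h
  beta_reduce at h2 h3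
  rw [Nat.factorization_mul (by positivity) (by positivity),
    Nat.factorization_mul (by positivity) (by positivity), Nat.prime_two.factorization_pow,
    Nat.prime_three.factorization_pow, Nat.prime_two.factorization_pow,
    Nat.prime_three.factorization_pow] at h2 h3
  simp at h2 h3
  exact ⟨h2, h3⟩

/-- The labelling determined by the edges of label `2` and the edges of label `3`. -/
noncomputable def lab (G2 G3 : SimpleGraph V) (e : Sym2 V) : ℕ :=
  if e ∈ G2.edgeSet then 2 else if e ∈ G3.edgeSet then 3 else 1

lemma prod_lab (G G2 G3 : SimpleGraph V) (h2 : G2 ≤ G) (h3 : G3 ≤ G)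
    (hd : ∀ a b, G2.Adj a b → ¬ G3.Adj a b) (v : V) (s : Finset (Sym2 V))
    (hs : ∀ e, e ∈ s ↔ e ∈ G.incidenceSet v) :
    ∏ e ∈ s, lab G2 G3 e = 2 ^ dg G2 v * 3 ^ dg G3 v := by
  have hs' : s = (univ.filter (fun w => G.Adj v w)).image (fun w => s(v, w)) := by
    ext e
    rw [hs, Finset.mem_image]
    constructor
    · intro he
      obtain ⟨w, rfl⟩ := Sym2.mem_iff_exists.1 he.2
      exact ⟨w, by simpa using he.1, rfl⟩
    · rintro ⟨w, hw, rfl⟩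
      rw [Finset.mem_filter_univ] at hw
      exact ⟨hw, by simp⟩
  rw [hs', Finset.prod_image (by intro a _ b _ h; exact Sym2.congr_right.1 h)]
  have e : ∀ w, lab G2 G3 s(v, w) = (if G2.Adj v w then 2 else 1) * (if G3.Adj v w then 3 else 1) := by
    intro w
    have := hd v w
    simp only [lab, SimpleGraph.mem_edgeSet]
    split_ifs <;> simp_all
  simp only [e]
  rw [Finset.prod_mul_distrib, Finset.prod_ite, Finset.prod_ite]
  simp only [Finset.prod_const, Finset.prod_const_one, mul_one, one_pow]
  congr 2
  · symm
    apply dg_eq_card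
    intro w
    simp only [Finset.mem_filter, Finset.mem_univ, true_and]
    exact ⟨fun h => ⟨h2 h, h⟩, fun h => h.2⟩
  · symm
    apply dg_eq_card
    intro w
    simp only [Finset.mem_filter, Finset.mem_univ, true_and]
    exact ⟨fun h => ⟨h3 h, h⟩, fun h => h.2⟩

end Aux3

/-- Every finite simple graph `G` admits a `3`-labelling of its edges such that the
subgraph induced by `S₁ = {v | ρ(v) = 1}` has maximum degree at most `1` (a possibly
empty matching plus isolated vertices), while for every `x ≠ 1` the set
`S_x = {v | ρ(v) = x}` is independent. -/
theorem stmt_1 {V : Type*} [Fintype V] [DecidableEq V] (G : SimpleGraph V)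
    [DecidableRel G.Adj] :
    ∃ ℓ : Sym2 V → ℕ,
      (∀ e ∈ G.edgeSet, ℓ e ∈ ({1, 2, 3} : Set ℕ)) ∧
      -- any conflict along an edge can only happen with common product 1,
      -- i.e. `S_x` is independent for every `x ≠ 1`
      (∀ u v : V, G.Adj u v → vertexProd G ℓ u = vertexProd G ℓ v →
        vertexProd G ℓ u = 1) ∧
      -- the subgraph induced by `S₁` has maximum degree at most 1
      (∀ v u w : V, vertexProd G ℓ v = 1 →
        G.Adj v u → G.Adj v w →
        vertexProd G ℓ u = 1 → vertexProd G ℓ w = 1 → u = w) := by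
  obtain ⟨G2, G3, h2, h3, hd, hc, hz⟩ := core G
  have hp : ∀ v, vertexProd G (lab G2 G3) v = 2 ^ dg G2 v * 3 ^ dg G3 v := by
    intro v
    exact prod_lab G G2 G3 h2 h3 hd v _ (fun e => by simp)
  have h1 : ∀ v, vertexProd G (lab G2 G3) v = 1 → dg G2 v = 0 ∧ dg G3 v = 0 := by
    intro v hv
    rw [hp] at hv
    exact two_three_inj _ _ 0 0 (by simpa using hv)
  refine ⟨lab G2 G3, ?_, ?_, ?_⟩
  · intro e _
    unfold lab
    split_ifs <;> simp
  · intro u v huv h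
    rw [hp, hp] at h
    obtain ⟨ha, hb⟩ := two_three_inj _ _ _ _ h
    obtain ⟨hu, hv⟩ := hc u v huv ha hb
    rw [hp, hu, hv]
    rfl
  · intro v u w hv hvu hvw hu hw
    obtain ⟨a1, a2⟩ := h1 v hv
    obtain ⟨b1, b2⟩ := h1 u hu
    obtain ⟨c1, c2⟩ := h1 w hw
    exact hz v u w hvu hvw a1 a2 b1 b2 c1 c2
end
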